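/- Let c ∈ 𝕋 with c ≠ 0, and let μ be a g-measure for g^c satisfying μ(⟨ω⟩) > 0 for every finite binary word ω. Then for every t ∈ ℝ one has log 2 · β̄_μ(t) = P̄_top(tψ^c) and log 2 · β̲_μ(t) = P̲_top(tψ^c), as equalities in ℝ ∪ {+∞}; in particular the L^q-spectrum of μ exists wherever the topological pressure exists as a limit, and then log 2 · β_μ(t) = P_top(tψ^c). -/

import Mathlib

open MeasureTheory Filter Topology Set
open scoped ENNReal

noncomputable section

namespace GTM

abbrev Torus := AddCircle (1 : ℝ)

instance : Fact ((0:ℝ) < 1) := ⟨one_pos⟩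

/-- The doubling map on the torus. -/
def dbl (x : Torus) : Torus := x + x

/-- The function `x ↦ |cos (π x)|` lifted to the torus. -/
def absCos : Torus → ℝ :=
  Function.Periodic.lift (f := fun x : ℝ => |Real.cos (Real.pi * x)|)
    (by
      intro x
      simp [mul_add, mul_one, Real.cos_add_pi, abs_neg])

/-- The potential `ψ^c(x) = 2 log |cos (π (x - c))|`, with value `⊥ = -∞` at the
singularity `c + 1/2`. -/
def psi (c : Torus) (x : Torus) : EReal :=
  if absCos (x - c) = 0 then ⊥ else ((2 * Real.log (absCos (x - c)) : ℝ) : EReal)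

/-- The Birkhoff sums `ψ^c_n` of the potential `ψ^c` under the doubling map. -/
def psiSum (c : Torus) (n : ℕ) (x : Torus) : EReal :=
  ∑ k ∈ Finset.range n, psi c (dbl^[k] x)

/-- The left endpoint of the dyadic cylinder interval of a binary word. -/
def wordVal (n : ℕ) (ω : Fin n → Bool) : ℝ :=
  ∑ i : Fin n, (if ω i then (1 : ℝ) else 0) / 2 ^ ((i : ℕ) + 1)

/-- The closed dyadic interval `⟨ω⟩ ⊆ 𝕋` associated to a binary word `ω`. -/
def cyl (n : ℕ) (ω : Fin n → Bool) : Set Torus :=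
  (fun x : ℝ => (x : Torus)) '' Set.Icc (wordVal n ω) (wordVal n ω + 1 / 2 ^ n)

/-- The exponential function on extended reals, `exp ⊥ = 0`, `exp ⊤ = ∞`. -/
def eexp (x : EReal) : ℝ≥0∞ :=
  if x = ⊥ then 0 else if x = ⊤ then ⊤ else ENNReal.ofReal (Real.exp x.toReal)

/-- The logarithm on `ℝ≥0∞`, `log 0 = ⊥`, `log ∞ = ⊤`. -/
def elog (x : ℝ≥0∞) : EReal :=
  if x = 0 then ⊥ else if x = ⊤ then ⊤ else ((Real.log x.toReal : ℝ) : EReal)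

/-- The partition function `Σ_{ω ∈ {0,1}ⁿ} exp (t · sup_{x ∈ ⟨ω⟩} ψ^c_n(x))`. -/
def presZ (c : Torus) (t : ℝ) (n : ℕ) : ℝ≥0∞ :=
  ∑ ω : Fin n → Bool, eexp ((t : EReal) * ⨆ x ∈ cyl n ω, psiSum c n x)

/-- The upper topological pressure `P̄_top(t ψ^c)`. -/
def presUpper (c : Torus) (t : ℝ) : EReal :=
  atTop.limsup fun n : ℕ => (((n : ℝ)⁻¹ : ℝ) : EReal) * elog (presZ c t n)

/-- The lower topological pressure `P̲_top(t ψ^c)`. -/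
def presLower (c : Torus) (t : ℝ) : EReal :=
  atTop.liminf fun n : ℕ => (((n : ℝ)⁻¹ : ℝ) : EReal) * elog (presZ c t n)

/-- The `g`-function `g^c(x) = cos² (π (x - c))`. -/
def gfun (c : Torus) (x : Torus) : ℝ := (absCos (x - c)) ^ 2

/-- The halving map `x ↦ x/2` on the torus, computed on the representative in `[0,1)`. -/
def half (x : Torus) : Torus := (((AddCircle.equivIco 1 0 x : ℝ) / 2 : ℝ) : Torus)

/-- `μ` is a `g`-measure for `g^c`: it is a Borel probability measure invariant under the
dual transfer operator of `g^c`. -/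
def IsGMeasure (c : Torus) (μ : Measure Torus) : Prop :=
  IsProbabilityMeasure μ ∧
    ∀ f : C(Torus, ℝ),
      ∫ x, f x ∂μ =
        ∫ x,
          (gfun c (half x) * f (half x) +
            gfun c (half x + (((1 : ℝ) / 2 : ℝ) : Torus)) *
              f (half x + (((1 : ℝ) / 2 : ℝ) : Torus))) ∂μ

/-- `Σ_{ω ∈ {0,1}ⁿ} ν(⟨ω⟩)^q`. -/
def lqSum (ν : Measure Torus) (q : ℝ) (n : ℕ) : ℝ :=
  ∑ ω : Fin n → Bool, ((ν (cyl n ω)).toReal) ^ q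

/-- The upper `L^q`-spectrum `β̄_ν(q)`. -/
def lqUpper (ν : Measure Torus) (q : ℝ) : EReal :=
  atTop.limsup fun n : ℕ =>
    ((((n : ℝ) * Real.log 2)⁻¹ * Real.log (lqSum ν q n) : ℝ) : EReal)

/-- The lower `L^q`-spectrum `β̲_ν(q)`. -/
def lqLower (ν : Measure Torus) (q : ℝ) : EReal :=
  atTop.liminf fun n : ℕ =>
    ((((n : ℝ) * Real.log 2)⁻¹ * Real.log (lqSum ν q n) : ℝ) : EReal)

/-- The singularity `c + 1/2` of `ψ^c`. -/
def antipode (c : Torus) : Torus := c + (((1 : ℝ) / 2 : ℝ) : Torus)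

/-- The product `∏_{k<n} g^c(T^k x)`, that is `exp (ψ^c_n(x))`. -/
def birkProd (c : Torus) (n : ℕ) (x : Torus) : ℝ :=
  ∏ k ∈ Finset.range n, gfun c (dbl^[k] x)

/-- The inverse branch of `dbl^[n]` attached to a word, in terms of a real representative. -/
def branch (n : ℕ) (ω : Fin n → Bool) (s : ℝ) : Torus :=
  ((wordVal n ω + s / 2 ^ n : ℝ) : Torus)

/-- The representative in `[0,1)` of a point of the torus. -/
def rep (x : Torus) : ℝ := (AddCircle.equivIco 1 0 x : ℝ)

lemma rep_mem (x : Torus) : rep x ∈ Ico (0 : ℝ) 1 := by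
  have := (AddCircle.equivIco (1 : ℝ) 0 x).2
  simpa [rep] using this

lemma coe_rep (x : Torus) : ((rep x : ℝ) : Torus) = x := AddCircle.coe_equivIco

lemma rep_coe {s : ℝ} (hs : s ∈ Ico (0 : ℝ) 1) : rep (s : Torus) = s := by
  have h : s ∈ Ico (0 : ℝ) (0 + 1) := by simpa using hs
  unfold rep
  rw [AddCircle.equivIco_coe_eq h]

lemma measurable_rep : Measurable rep :=
  measurable_subtype_coe.comp (AddCircle.measurableEquivIco (1 : ℝ) 0).measurable

lemma half_eq (x : Torus) : half x = ((rep x / 2 : ℝ) : Torus) := rfl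

lemma measurable_coe_torus : Measurable (fun s : ℝ => (s : Torus)) :=
  (AddCircle.continuous_mk' 1).measurable

lemma measurable_half : Measurable half := by
  have : half = fun x => ((rep x / 2 : ℝ) : Torus) := rfl
  rw [this]
  exact measurable_coe_torus.comp (measurable_rep.div_const 2)

lemma absCos_coe (s : ℝ) : absCos (s : Torus) = |Real.cos (Real.pi * s)| := rfl

lemma continuous_absCos : Continuous absCos := by
  refine continuous_coinduced_dom.mpr ?_
  change Continuous fun s : ℝ => |Real.cos (Real.pi * s)|
  fun_prop

lemma absCos_nonneg (x : Torus) : 0 ≤ absCos x := by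
  induction x using QuotientAddGroup.induction_on with
  | H s => exact abs_nonneg _

lemma absCos_le_one (x : Torus) : absCos x ≤ 1 := by
  induction x using QuotientAddGroup.induction_on with
  | H s => exact Real.abs_cos_le_one _

lemma exists_rep_norm (u : Torus) : ∃ s : ℝ, (s : Torus) = u ∧ |s| = ‖u‖ ∧ |s| ≤ 1 / 2 := by
  induction u using QuotientAddGroup.induction_on with
  | H s =>
    refine ⟨s - round s, ?_, ?_, abs_sub_round s⟩
    · rw [AddCircle.coe_sub, sub_eq_self]
      exact (AddCircle.coe_eq_zero_iff 1).2 ⟨round s, by simp⟩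
    · exact (UnitAddCircle.norm_eq (x := s)).symm

lemma norm_le_half (u : Torus) : ‖u‖ ≤ 1 / 2 := by
  obtain ⟨s, -, h, h'⟩ := exists_rep_norm u
  rwa [← h]

lemma absCos_sub_eq (c x : Torus) : ∃ s : ℝ, |s| = ‖x - antipode c‖ ∧ |s| ≤ 1 / 2 ∧
    absCos (x - c) = |Real.sin (Real.pi * s)| := by
  obtain ⟨s, h1, h2, h3⟩ := exists_rep_norm (x - antipode c)
  refine ⟨s, h2, h3, ?_⟩
  have : x - c = ((s + 1 / 2 : ℝ) : Torus) := by
    rw [AddCircle.coe_add, h1, antipode]; abel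
  rw [this, absCos_coe, mul_add, mul_one_div, Real.cos_add_pi_div_two, abs_neg]

lemma two_mul_norm_le_absCos (c x : Torus) : 2 * ‖x - antipode c‖ ≤ absCos (x - c) := by
  obtain ⟨s, h1, h2, h3⟩ := absCos_sub_eq c x
  rw [h3, ← h1]
  have h : |Real.pi * s| ≤ Real.pi / 2 := by
    rw [abs_mul, abs_of_pos Real.pi_pos]
    nlinarith [Real.pi_pos]
  have := Real.mul_abs_le_abs_sin h
  rw [abs_mul, abs_of_pos Real.pi_pos] at this
  have e : 2 / Real.pi * (Real.pi * |s|) = 2 * |s| := by field_simp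
  linarith

lemma absCos_le_pi_mul_norm (c x : Torus) : absCos (x - c) ≤ Real.pi * ‖x - antipode c‖ := by
  obtain ⟨s, h1, h2, h3⟩ := absCos_sub_eq c x
  rw [h3, ← h1]
  calc |Real.sin (Real.pi * s)| ≤ |Real.pi * s| := Real.abs_sin_le_abs
    _ = _ := by rw [abs_mul, abs_of_pos Real.pi_pos]

lemma absCos_eq_zero_iff (c x : Torus) : absCos (x - c) = 0 ↔ x = antipode c := by
  constructor
  · intro h
    have := two_mul_norm_le_absCos c x
    have h0 := norm_nonneg (x - antipode c)
    have : ‖x - antipode c‖ = 0 := by linarith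
    exact sub_eq_zero.1 (norm_eq_zero.1 this)
  · rintro rfl
    have := absCos_le_pi_mul_norm c (antipode c)
    simp only [sub_self, norm_zero, mul_zero] at this
    exact le_antisymm this (absCos_nonneg _)

lemma absCos_sub_absCos_le (x y : Torus) : absCos x - absCos y ≤ Real.pi * ‖x - y‖ := by
  obtain ⟨s, h1, h2, -⟩ := exists_rep_norm (x - y)
  induction y using QuotientAddGroup.induction_on with
  | H t =>
    have hx : x = ((s + t : ℝ) : Torus) := by
      rw [AddCircle.coe_add, h1]; exact (sub_add_cancel _ _).symm
    change absCos x - absCos ((t : ℝ) : Torus) ≤ Real.pi * ‖x - ((t : ℝ) : Torus)‖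
    change |s| = ‖x - ((t : ℝ) : Torus)‖ at h2
    rw [← h2, hx, absCos_coe, absCos_coe]
    calc |Real.cos (Real.pi * (s + t))| - |Real.cos (Real.pi * t)|
        ≤ |Real.cos (Real.pi * (s + t)) - Real.cos (Real.pi * t)| := abs_sub_abs_le_abs_sub _ _
      _ ≤ |Real.pi * (s + t) - Real.pi * t| := by
          have := Real.lipschitzWith_cos.dist_le_mul (Real.pi * (s + t)) (Real.pi * t)
          simpa [Real.dist_eq] using this
      _ = Real.pi * |s| := by
          rw [← mul_sub, add_sub_cancel_right, abs_mul, abs_of_pos Real.pi_pos]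

lemma absCos_eq_one {x : Torus} (h : absCos x = 1) : x = 0 := by
  obtain ⟨s, hs, -, -⟩ := exists_rep_norm x
  rw [← hs] at h ⊢
  rw [absCos_coe] at h
  have hsin : Real.sin (Real.pi * s) = 0 := by
    have := Real.sin_sq_add_cos_sq (Real.pi * s)
    rw [← sq_abs (Real.cos _), h] at this
    nlinarith
  rw [Real.sin_eq_zero_iff] at hsin
  obtain ⟨n, hn⟩ := hsin
  refine (AddCircle.coe_eq_zero_iff 1).2 ⟨n, ?_⟩
  have := Real.pi_pos
  simp only [zsmul_eq_mul, mul_one]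
  nlinarith [mul_left_cancel₀ this.ne' (a := Real.pi) (b := (n : ℝ)) (c := s) (by linarith)]

lemma gfun_nonneg (c x : Torus) : 0 ≤ gfun c x := sq_nonneg _

lemma gfun_le_one (c x : Torus) : gfun c x ≤ 1 :=
  pow_le_one₀ (absCos_nonneg _) (absCos_le_one _)

lemma continuous_gfun (c : Torus) : Continuous (gfun c) :=
  (continuous_absCos.comp (continuous_id.sub continuous_const)).pow 2

lemma continuous_dbl : Continuous dbl := continuous_id.add continuous_id

lemma birkProd_nonneg (c : Torus) (n : ℕ) (x : Torus) : 0 ≤ birkProd c n x :=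
  Finset.prod_nonneg fun _ _ => gfun_nonneg _ _

lemma continuous_birkProd (c : Torus) (n : ℕ) : Continuous (birkProd c n) :=
  continuous_finsetProd _ fun k _ => (continuous_gfun c).comp (continuous_dbl.iterate k)

lemma dbl_iterate (k : ℕ) (x : Torus) : dbl^[k] x = (2 ^ k : ℕ) • x := by
  induction k with
  | zero => simp
  | succ k ih => rw [Function.iterate_succ_apply', ih, dbl, pow_succ, mul_smul, two_smul, smul_add]

lemma dbl_iterate_sub (k : ℕ) (x y : Torus) : dbl^[k] (x - y) = dbl^[k] x - dbl^[k] y := by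
  simp only [dbl_iterate, smul_sub]

lemma dbl_iterate_coe (k : ℕ) (s : ℝ) : dbl^[k] (s : Torus) = ((2 ^ k * s : ℝ) : Torus) := by
  rw [dbl_iterate, ← AddCircle.coe_nsmul]; simp

lemma norm_dbl_iterate_le (k : ℕ) (x : Torus) : ‖dbl^[k] x‖ ≤ 2 ^ k * ‖x‖ := by
  rw [dbl_iterate]
  simpa using norm_nsmul_le (n := 2 ^ k) (a := x)

lemma wordVal_snoc (n : ℕ) (ω : Fin n → Bool) (b : Bool) :
    wordVal (n + 1) (Fin.snoc (α := fun _ => Bool) ω b) =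
      wordVal n ω + (if b then (1 : ℝ) else 0) / 2 ^ (n + 1) := by
  simp [wordVal, Fin.sum_univ_castSucc]

lemma branch_snoc (n : ℕ) (ω : Fin n → Bool) (b : Bool) (s : ℝ) :
    branch (n + 1) (Fin.snoc (α := fun _ => Bool) ω b) s =
      branch n ω (((if b then (1 : ℝ) else 0) + s) / 2) := by
  rw [branch, branch, wordVal_snoc, pow_succ]
  congr 1
  field_simp
  ring

lemma exists_snoc (n : ℕ) (ω : Fin (n + 1) → Bool) :
    ∃ (ω' : Fin n → Bool) (b : Bool), ω = Fin.snoc (α := fun _ => Bool) ω' b :=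
  ⟨Fin.init ω, ω (Fin.last n), (Fin.snoc_init_self ω).symm⟩

lemma branch_zero (ω : Fin 0 → Bool) (s : ℝ) : branch 0 ω s = (s : Torus) := by
  simp [branch, wordVal]

lemma dbl_iterate_branch (n : ℕ) (ω : Fin n → Bool) (s : ℝ) : dbl^[n] (branch n ω s) = s := by
  induction n generalizing s with
  | zero => simp [branch_zero]
  | succ n ih =>
    obtain ⟨ω, b, rfl⟩ := exists_snoc n ω
    rw [branch_snoc, Function.iterate_succ_apply', ih, dbl, ← AddCircle.coe_add, add_halves]
    cases b
    · simp
    · simp only [if_true]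
      rw [AddCircle.coe_add, AddCircle.coe_period, zero_add]

lemma digit_mem (b : Bool) {s : ℝ} (hs : s ∈ Ico (0 : ℝ) 1) :
    ((if b then (1 : ℝ) else 0) + s) / 2 ∈ Ico (0 : ℝ) 1 := by
  obtain ⟨h1, h2⟩ := hs
  cases b <;> constructor <;> simp <;> linarith

lemma branch_injective (n : ℕ) (ω ω' : Fin n → Bool) (s s' : ℝ) (hs : s ∈ Ico (0 : ℝ) 1)
    (hs' : s' ∈ Ico (0 : ℝ) 1) (h : branch n ω s = branch n ω' s') : ω = ω' ∧ s = s' := by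
  induction n generalizing s s' with
  | zero =>
    rw [branch_zero, branch_zero] at h
    refine ⟨Subsingleton.elim _ _, ?_⟩
    rw [← rep_coe hs, ← rep_coe hs', h]
  | succ n ih =>
    obtain ⟨ω, b, rfl⟩ := exists_snoc n ω
    obtain ⟨ω', b', rfl⟩ := exists_snoc n ω'
    rw [branch_snoc, branch_snoc] at h
    obtain ⟨h1, h2⟩ := ih ω ω' _ _ (digit_mem b hs) (digit_mem b' hs') h
    obtain ⟨h3, h4⟩ := hs
    obtain ⟨h5, h6⟩ := hs'
    subst h1
    cases b <;> cases b' <;> simp at h2 ⊢ <;> linarith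

lemma exists_branch_real (n : ℕ) (s : ℝ) (hs : s ∈ Ico (0 : ℝ) 1) :
    ∃ ω : Fin n → Bool, s ∈ Icc (wordVal n ω) (wordVal n ω + 1 / 2 ^ n) := by
  suffices h : ∃ ω : Fin n → Bool, ∃ s' ∈ Ico (0 : ℝ) 1, s = wordVal n ω + s' / 2 ^ n by
    obtain ⟨ω, s', ⟨h1, h2⟩, rfl⟩ := h
    refine ⟨ω, by simp; positivity, ?_⟩
    gcongr
  induction n with
  | zero => exact ⟨fun _ => false, s, hs, by simp [wordVal]⟩
  | succ n ih =>
    obtain ⟨ω, s', ⟨h1, h2⟩, rfl⟩ := ih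
    rcases lt_or_ge s' (1 / 2) with h | h
    · refine ⟨Fin.snoc (α := fun _ => Bool) ω false, 2 * s', ⟨by linarith, by linarith⟩, ?_⟩
      rw [wordVal_snoc, pow_succ]
      field_simp
      simp
      ring
    · refine ⟨Fin.snoc (α := fun _ => Bool) ω true, 2 * s' - 1, ⟨by linarith, by linarith⟩, ?_⟩
      rw [wordVal_snoc, pow_succ]
      field_simp
      simp
      ring

lemma branch_mem_cyl (n : ℕ) (ω : Fin n → Bool) {s : ℝ} (hs : s ∈ Icc (0 : ℝ) 1) :
    branch n ω s ∈ cyl n ω := by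
  refine ⟨_, ⟨?_, ?_⟩, rfl⟩
  · have := hs.1
    simp; positivity
  · have := hs.2
    gcongr

lemma exists_branch_of_mem_cyl {n : ℕ} {ω : Fin n → Bool} {x : Torus} (hx : x ∈ cyl n ω) :
    ∃ s ∈ Icc (0 : ℝ) 1, x = branch n ω s := by
  obtain ⟨y, ⟨h1, h2⟩, rfl⟩ := hx
  have hp : (0 : ℝ) < 2 ^ n := by positivity
  refine ⟨(y - wordVal n ω) * 2 ^ n, ⟨?_, ?_⟩, ?_⟩
  · have : 0 ≤ y - wordVal n ω := by linarith
    positivity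
  · have : y - wordVal n ω ≤ 1 / 2 ^ n := by linarith
    calc (y - wordVal n ω) * 2 ^ n ≤ 1 / 2 ^ n * 2 ^ n := by gcongr
      _ = 1 := one_div_mul_cancel hp.ne'
  · change (y : Torus) = _
    rw [branch]
    congr 1
    field_simp
    ring

lemma isCompact_cyl (n : ℕ) (ω : Fin n → Bool) : IsCompact (cyl n ω) :=
  isCompact_Icc.image (AddCircle.continuous_mk' 1)

/-- The other inverse branch of the doubling map. -/
def half' (x : Torus) : Torus := half x + (((1 : ℝ) / 2 : ℝ) : Torus)

lemma measurable_half' : Measurable half' := measurable_half.add_const _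

lemma half'_eq (x : Torus) : half' x = (((1 + rep x) / 2 : ℝ) : Torus) := by
  rw [half', half_eq, ← AddCircle.coe_add]
  congr 1
  ring

lemma rep_half (x : Torus) : rep (half x) = rep x / 2 := by
  obtain ⟨h1, h2⟩ := rep_mem x
  rw [half_eq, rep_coe ⟨by linarith, by linarith⟩]

lemma rep_half' (x : Torus) : rep (half' x) = (1 + rep x) / 2 := by
  obtain ⟨h1, h2⟩ := rep_mem x
  rw [half'_eq, rep_coe ⟨by linarith, by linarith⟩]

lemma measurable_branch (n : ℕ) (ω : Fin n → Bool) : Measurable (branch n ω) :=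
  measurable_coe_torus.comp (by fun_prop)

lemma continuous_branch (n : ℕ) (ω : Fin n → Bool) : Continuous (branch n ω) :=
  (AddCircle.continuous_mk' 1).comp (by fun_prop)

lemma IsGMeasure.lintegral_eq {c : Torus} {μ : Measure Torus} (hμ : IsGMeasure c μ)
    {f : Torus → ℝ≥0∞} (hf : Measurable f) :
    ∫⁻ x, f x ∂μ = ∫⁻ x, (ENNReal.ofReal (gfun c (half x)) * f (half x) +
      ENNReal.ofReal (gfun c (half' x)) * f (half' x)) ∂μ := by
  obtain ⟨hp, hinv⟩ := hμ
  have hg := (continuous_gfun c).measurable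
  have m1 : Measurable fun x => (gfun c (half x)).toNNReal :=
    (hg.comp measurable_half).real_toNNReal
  have m2 : Measurable fun x => (gfun c (half' x)).toNNReal :=
    (hg.comp measurable_half').real_toNNReal
  set ν₁ := μ.withDensity fun x => ((gfun c (half x)).toNNReal : ℝ≥0∞) with hν₁
  set ν₂ := μ.withDensity fun x => ((gfun c (half' x)).toNNReal : ℝ≥0∞) with hν₂
  have hle : ∀ x, ((gfun c x).toNNReal : ℝ≥0∞) ≤ 1 := fun x => by
    have := gfun_le_one c x
    exact_mod_cast Real.toNNReal_le_one.2 this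
  have f1 : IsFiniteMeasure ν₁ := by
    refine isFiniteMeasure_withDensity ?_
    refine ((lintegral_mono fun x => hle (half x)).trans_lt ?_).ne
    simp
  have f2 : IsFiniteMeasure ν₂ := by
    refine isFiniteMeasure_withDensity ?_
    refine ((lintegral_mono fun x => hle (half' x)).trans_lt ?_).ne
    simp
  have key : μ = ν₁.map half + ν₂.map half' := by
    refine ext_of_forall_integral_eq_of_IsFiniteMeasure fun φ => ?_
    have hb : ∀ (ν : Measure Torus) [IsFiniteMeasure ν] (k : Torus → Torus), Measurable k →
        Integrable (fun x => φ (k x)) ν := fun ν _ k hk =>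
      Integrable.of_bound (φ.continuous.measurable.comp hk).aestronglyMeasurable ‖φ‖
        (Eventually.of_forall fun x => φ.norm_coe_le_norm _)
    have hb' : ∀ (k : Torus → Torus), Measurable k →
        Integrable (fun x => gfun c (k x) * φ (k x)) μ := fun k hk => by
      refine Integrable.of_bound ((hg.comp hk).mul
        (φ.continuous.measurable.comp hk)).aestronglyMeasurable ‖φ‖
        (Eventually.of_forall fun x => ?_)
      rw [norm_mul, Real.norm_of_nonneg (gfun_nonneg c _)]
      calc _ ≤ 1 * ‖φ‖ := by
            gcongr
            · exact gfun_le_one c _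
            · exact φ.norm_coe_le_norm _
        _ = _ := one_mul _
    have h1 : Integrable (fun x => φ x) (ν₁.map half) := hb _ id measurable_id
    have h2 : Integrable (fun x => φ x) (ν₂.map half') := hb _ id measurable_id
    rw [integral_add_measure h1 h2,
      integral_map measurable_half.aemeasurable φ.continuous.measurable.aestronglyMeasurable,
      integral_map measurable_half'.aemeasurable φ.continuous.measurable.aestronglyMeasurable,
      hν₁, hν₂, integral_withDensity_eq_integral_smul m1, integral_withDensity_eq_integral_smul m2]
    have e : ∀ x (r : ℝ), (gfun c x).toNNReal • r = gfun c x * r := fun x r => by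
      rw [NNReal.smul_def, Real.coe_toNNReal _ (gfun_nonneg c x), smul_eq_mul]
    simp only [e]
    rw [← integral_add (hb' _ measurable_half) (hb' _ measurable_half')]
    exact hinv φ.toContinuousMap
  have k1 : Measurable fun x => f (half x) := hf.comp measurable_half
  have k2 : Measurable fun x => f (half' x) := hf.comp measurable_half'
  conv_lhs => rw [key]
  rw [lintegral_add_measure, lintegral_map hf measurable_half, lintegral_map hf measurable_half',
    hν₁, hν₂, lintegral_withDensity_eq_lintegral_mul _ m1.coe_nnreal_ennreal k1,
    lintegral_withDensity_eq_lintegral_mul _ m2.coe_nnreal_ennreal k2,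
    ← lintegral_add_left]
  · rfl
  · exact m1.coe_nnreal_ennreal.mul k1

lemma birkProd_succ (c : Torus) (n : ℕ) (x : Torus) :
    birkProd c (n + 1) x = birkProd c n x * gfun c (dbl^[n] x) :=
  Finset.prod_range_succ _ _

lemma sum_word_succ {M : Type*} [AddCommMonoid M] (n : ℕ) (F : (Fin (n + 1) → Bool) → M) :
    ∑ ω, F ω = ∑ ω : Fin n → Bool, (F (Fin.snoc (α := fun _ => Bool) ω false) +
      F (Fin.snoc (α := fun _ => Bool) ω true)) := by
  rw [← (Fin.snocEquiv fun _ => Bool).sum_comp, Fintype.sum_prod_type_right]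
  refine Finset.sum_congr rfl fun ω _ => ?_
  rw [Fintype.sum_bool, add_comm]
  rfl

lemma IsGMeasure.lintegral_eq_iterate {c : Torus} {μ : Measure Torus} (hμ : IsGMeasure c μ)
    {f : Torus → ℝ≥0∞} (hf : Measurable f) (n : ℕ) :
    ∫⁻ x, f x ∂μ = ∫⁻ x, ∑ ω : Fin n → Bool, ENNReal.ofReal (birkProd c n (branch n ω (rep x))) *
      f (branch n ω (rep x)) ∂μ := by
  induction n with
  | zero =>
    refine lintegral_congr fun x => ?_
    simp [branch_zero, coe_rep, birkProd]
  | succ n ih =>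
    have hm : Measurable fun x => ∑ ω : Fin n → Bool,
        ENNReal.ofReal (birkProd c n (branch n ω (rep x))) * f (branch n ω (rep x)) := by
      refine Finset.measurable_fun_sum _ fun ω _ => ?_
      have := (measurable_branch n ω).comp measurable_rep
      exact ((continuous_birkProd c n).measurable.comp this).ennreal_ofReal.mul (hf.comp this)
    rw [ih, hμ.lintegral_eq hm]
    refine lintegral_congr fun x => ?_
    rw [sum_word_succ, Finset.sum_add_distrib, Finset.mul_sum, Finset.mul_sum]
    congr 1
    · refine Finset.sum_congr rfl fun ω _ => ?_
      rw [rep_half, branch_snoc, birkProd_succ, dbl_iterate_branch,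
        ENNReal.ofReal_mul (birkProd_nonneg _ _ _), half_eq]
      simp only [Bool.false_eq_true, if_false, zero_add]
      ring
    · refine Finset.sum_congr rfl fun ω _ => ?_
      rw [rep_half', branch_snoc, birkProd_succ, dbl_iterate_branch,
        ENNReal.ofReal_mul (birkProd_nonneg _ _ _), half'_eq]
      simp only [if_true]
      ring

/-- A set on which `dbl^[n]` is injective has measure at most the supremum of `birkProd`. -/
lemma IsGMeasure.measure_le {c : Torus} {μ : Measure Torus} (hμ : IsGMeasure c μ) {A : Set Torus}
    (hA : MeasurableSet A) (n : ℕ) (hinj : InjOn dbl^[n] A) {B : ℝ}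
    (hB : ∀ y ∈ A, birkProd c n y ≤ B) : μ A ≤ ENNReal.ofReal B := by
  have := hμ.1
  have h := hμ.lintegral_eq_iterate (measurable_one.indicator hA) n (f := A.indicator 1)
  rw [lintegral_indicator_one hA] at h
  rw [h]
  calc _ ≤ ∫⁻ _, ENNReal.ofReal B ∂μ := lintegral_mono fun x => ?_
    _ = _ := by simp
  by_cases hx : ∃ ω : Fin n → Bool, branch n ω (rep x) ∈ A
  · obtain ⟨ω, hω⟩ := hx
    dsimp only
    rw [Finset.sum_eq_single ω]
    · rw [indicator_of_mem hω, Pi.one_apply, mul_one]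
      exact ENNReal.ofReal_le_ofReal (hB _ hω)
    · intro ω' _ hne
      rw [indicator_of_notMem, mul_zero]
      intro hω'
      refine hne (branch_injective n ω' ω _ _ (rep_mem x) (rep_mem x) (hinj hω' hω ?_)).1
      rw [dbl_iterate_branch, dbl_iterate_branch]
    · simp
  · push Not at hx
    simp [indicator_of_notMem (hx _)]

/-- The measure of a cylinder is at most twice the supremum of `birkProd`. -/
lemma IsGMeasure.measure_cyl_le {c : Torus} {μ : Measure Torus} (hμ : IsGMeasure c μ) (n : ℕ)
    (ω : Fin n → Bool) {B : ℝ} (hB : ∀ y ∈ cyl n ω, birkProd c n y ≤ B) :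
    μ (cyl n ω) ≤ 2 * ENNReal.ofReal B := by
  set e := branch n ω 1
  have he : e ∈ cyl n ω := branch_mem_cyl n ω (by simp)
  have h1 : μ {e} ≤ ENNReal.ofReal B :=
    hμ.measure_le (measurableSet_singleton _) n (by simp) (by simpa using hB e he)
  have h2 : μ (cyl n ω \ {e}) ≤ ENNReal.ofReal B := by
    refine hμ.measure_le ((isCompact_cyl n ω).measurableSet.diff (measurableSet_singleton _)) n ?_
      fun y hy => hB y hy.1
    have aux : ∀ y ∈ cyl n ω \ {e}, ∃ s ∈ Ico (0 : ℝ) 1, y = branch n ω s := by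
      rintro y ⟨hy, hne⟩
      obtain ⟨s, hs, rfl⟩ := exists_branch_of_mem_cyl hy
      refine ⟨s, ⟨hs.1, lt_of_le_of_ne hs.2 ?_⟩, rfl⟩
      rintro rfl
      exact hne rfl
    intro y hy y' hy' hyy
    obtain ⟨s, hs, rfl⟩ := aux y hy
    obtain ⟨s', hs', rfl⟩ := aux y' hy'
    simp only [dbl_iterate_branch] at hyy
    rw [← rep_coe hs, ← rep_coe hs', hyy]
  calc μ (cyl n ω) ≤ μ (cyl n ω \ {e} ∪ {e}) := measure_mono (by simp)
    _ ≤ μ (cyl n ω \ {e}) + μ {e} := measure_union_le _ _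
    _ ≤ _ := by rw [two_mul]; gcongr

/-- Lower bound for the measure of a cylinder. -/
lemma IsGMeasure.le_measure_cyl {c : Torus} {μ : Measure Torus} (hμ : IsGMeasure c μ) (n : ℕ)
    (ω : Fin n → Bool) {A : Set Torus} {B : ℝ}
    (hB : ∀ x ∈ A, B ≤ birkProd c n (branch n ω (rep x))) :
    ENNReal.ofReal B * μ A ≤ μ (cyl n ω) := by
  have hc := (isCompact_cyl n ω).measurableSet
  have h := hμ.lintegral_eq_iterate (measurable_one.indicator hc) n (f := (cyl n ω).indicator 1)
  rw [lintegral_indicator_one hc] at h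
  rw [h]
  calc ENNReal.ofReal B * μ A ≤ ENNReal.ofReal B *
          μ {x | ENNReal.ofReal B ≤ ENNReal.ofReal (birkProd c n (branch n ω (rep x)))} := by
        gcongr
        intro x hx
        exact ENNReal.ofReal_le_ofReal (hB x hx)
    _ ≤ ∫⁻ x, ENNReal.ofReal (birkProd c n (branch n ω (rep x))) ∂μ :=
        mul_meas_ge_le_lintegral ((continuous_birkProd c n).measurable.comp
          ((measurable_branch n ω).comp measurable_rep)).ennreal_ofReal _
    _ ≤ _ := lintegral_mono fun x => by
        refine le_trans ?_ (Finset.single_le_sum (fun _ _ => zero_le) (Finset.mem_univ ω))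
        have hm := branch_mem_cyl n ω ⟨(rep_mem x).1, (rep_mem x).2.le⟩
        simp [indicator_of_mem hm]

lemma gfun_eq_one {c x : Torus} (h : gfun c x = 1) : x = c := by
  have h1 := absCos_nonneg (x - c)
  have : absCos (x - c) = 1 := by
    unfold gfun at h
    nlinarith
  exact sub_eq_zero.1 (absCos_eq_one this)

/-- If `c ≠ 0`, the products `birkProd c n` decay uniformly exponentially. -/
lemma exists_birkProd_le {c : Torus} (hc : c ≠ 0) :
    ∃ ρ : ℝ, 0 < ρ ∧ ρ < 1 ∧ ∀ n x, birkProd c n x ≤ ρ ^ n / ρ := by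
  have hcont : Continuous fun x => gfun c x * gfun c (dbl x) :=
    (continuous_gfun c).mul ((continuous_gfun c).comp continuous_dbl)
  obtain ⟨x₀, -, hx₀⟩ := isCompact_univ.exists_isMaxOn (univ_nonempty (α := Torus))
    hcont.continuousOn
  have hlt : gfun c x₀ * gfun c (dbl x₀) < 1 := by
    have a1 := gfun_nonneg c x₀
    have a2 := gfun_le_one c x₀
    have a3 := gfun_nonneg c (dbl x₀)
    have a4 := gfun_le_one c (dbl x₀)
    by_contra! hge
    have e1 : gfun c x₀ = 1 := by nlinarith
    have e2 : gfun c (dbl x₀) = 1 := by nlinarith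
    have e3 := gfun_eq_one e1
    have e4 := gfun_eq_one e2
    rw [e3, dbl] at e4
    exact hc (by simpa using e4)
  set θ := max (gfun c x₀ * gfun c (dbl x₀)) (1 / 2) with hθ
  have hθ1 : θ < 1 := max_lt hlt (by norm_num)
  have hθ0 : 0 < θ := lt_of_lt_of_le (by norm_num) (le_max_right _ _)
  refine ⟨√θ, Real.sqrt_pos.2 hθ0, (Real.sqrt_lt' one_pos).2 (by simpa using hθ1), ?_⟩
  have hs0 : 0 < √θ := Real.sqrt_pos.2 hθ0
  have hs1 : √θ ≤ 1 := Real.sqrt_le_one.2 hθ1.le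
  intro n
  induction n using Nat.twoStepInduction with
  | zero =>
    intro x
    simpa [birkProd] using (one_le_inv₀ hs0).2 hs1
  | one =>
    intro x
    simpa [birkProd, div_self hs0.ne'] using gfun_le_one c x
  | more n ih _ =>
    intro x
    have hle : gfun c (dbl^[n] x) * gfun c (dbl^[n + 1] x) ≤ θ := by
      rw [Function.iterate_succ_apply']
      exact (hx₀ (mem_univ (dbl^[n] x))).trans (le_max_left _ _)
    rw [birkProd_succ, birkProd_succ, mul_assoc]
    calc _ ≤ √θ ^ n / √θ * θ := by
          gcongr
          · exact mul_nonneg (gfun_nonneg _ _) (gfun_nonneg _ _)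
          · exact ih x
      _ = _ := by
          rw [pow_add, Real.sq_sqrt hθ0.le]
          ring

lemma injOn_dbl_iterate_closedBall (n : ℕ) (z : Torus) :
    InjOn dbl^[n] (Metric.closedBall z (1 / 2 ^ (n + 2))) := by
  intro y hy y' hy' h
  rw [Metric.mem_closedBall, dist_eq_norm] at hy hy'
  have h0 : dbl^[n] (y - y') = 0 := by rw [dbl_iterate_sub, h, sub_self]
  have hn : ‖y - y'‖ ≤ 1 / 2 ^ (n + 1) := by
    calc ‖y - y'‖ = ‖(y - z) - (y' - z)‖ := by rw [sub_sub_sub_cancel_right]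
      _ ≤ ‖y - z‖ + ‖y' - z‖ := norm_sub_le _ _
      _ ≤ 1 / 2 ^ (n + 2) + 1 / 2 ^ (n + 2) := add_le_add hy hy'
      _ = _ := by rw [pow_succ _ (n + 1)]; field_simp; norm_num
  obtain ⟨s, hs1, hs2, -⟩ := exists_rep_norm (y - y')
  rw [← hs1, dbl_iterate_coe] at h0
  obtain ⟨m, hm⟩ := (AddCircle.coe_eq_zero_iff 1).1 h0
  simp only [zsmul_eq_mul, mul_one] at hm
  have hlt : |(m : ℝ)| < 1 := by
    rw [hm, abs_mul, hs2, abs_of_pos (by positivity : (0 : ℝ) < 2 ^ n)]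
    calc (2 : ℝ) ^ n * ‖y - y'‖ ≤ 2 ^ n * (1 / 2 ^ (n + 1)) := by gcongr
      _ = 1 / 2 := by rw [pow_succ]; field_simp
      _ < 1 := by norm_num
  have hm0 : m = 0 := by
    have : |m| < 1 := by exact_mod_cast hlt
    exact Int.abs_lt_one_iff.1 this
  rw [hm0, Int.cast_zero] at hm
  have : s = 0 := by
    rcases mul_eq_zero.1 hm.symm with h | h
    · exact absurd h (by positivity)
    · exact h
  rw [this, abs_zero] at hs2
  exact sub_eq_zero.1 (norm_eq_zero.1 hs2.symm)

lemma IsGMeasure.measure_closedBall_le {c : Torus} {μ : Measure Torus} (hμ : IsGMeasure c μ)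
    {ρ : ℝ} (h0 : 0 < ρ) (h1 : ρ < 1) (hρ : ∀ n x, birkProd c n x ≤ ρ ^ n / ρ) (i : ℕ)
    (z : Torus) : μ (Metric.closedBall z (1 / 2 ^ i)) ≤ ENNReal.ofReal (ρ ^ i / ρ ^ 3) := by
  have := hμ.1
  rcases Nat.lt_or_ge i 2 with hi | hi
  · refine prob_le_one.trans ?_
    rw [ENNReal.one_le_ofReal, one_le_div (by positivity)]
    exact pow_le_pow_of_le_one h0.le h1.le (by omega)
  · obtain ⟨n, rfl⟩ := Nat.exists_eq_add_of_le' hi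
    refine (hμ.measure_le Metric.isClosed_closedBall.measurableSet n
      (injOn_dbl_iterate_closedBall n z) fun y _ => hρ n y).trans (le_of_eq ?_)
    congr 1
    rw [pow_add]
    field_simp

lemma IsGMeasure.measure_singleton {c : Torus} {μ : Measure Torus} (hμ : IsGMeasure c μ)
    (hc : c ≠ 0) (y : Torus) : μ {y} = 0 := by
  obtain ⟨ρ, h0, h1, hρ⟩ := exists_birkProd_le hc
  refine le_antisymm ?_ zero_le
  have hle : ∀ n : ℕ, μ {y} ≤ ENNReal.ofReal (ρ ^ n / ρ) := fun n =>
    hμ.measure_le (measurableSet_singleton _) n (by simp) fun x _ => hρ n x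
  have ht : Tendsto (fun n : ℕ => ENNReal.ofReal (ρ ^ n / ρ)) atTop (𝓝 (ENNReal.ofReal 0)) :=
    ENNReal.tendsto_ofReal ?_
  · rw [ENNReal.ofReal_zero] at ht
    exact ge_of_tendsto' ht hle
  simpa using (tendsto_pow_atTop_nhds_zero_of_lt_one h0.le h1).div_const ρ

lemma ofReal_neg_log_le (r : ℝ) (h0 : 0 ≤ r) (h1 : r ≤ 1) : ENNReal.ofReal (-Real.log r) ≤
    ∑' i : ℕ, (Iic ((1 : ℝ) / 2 ^ i)).indicator (fun _ => ENNReal.ofReal (Real.log 2)) r := by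
  rcases h0.eq_or_lt with rfl | h0
  · simp
  obtain ⟨n, hn1, hn2⟩ := exists_nat_pow_near_of_lt_one h0 h1 (y := (1 / 2 : ℝ)) (by norm_num)
    (by norm_num)
  refine le_trans ?_ (ENNReal.sum_le_tsum (Finset.range (n + 1)))
  calc ENNReal.ofReal (-Real.log r) ≤ ENNReal.ofReal ((n + 1 : ℕ) * Real.log 2) := by
        refine ENNReal.ofReal_le_ofReal ?_
        have := Real.log_le_log (by positivity) hn1.le
        rw [Real.log_pow, one_div, Real.log_inv] at this
        linarith
    _ = ∑ i ∈ Finset.range (n + 1), ENNReal.ofReal (Real.log 2) := by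
        rw [Finset.sum_const, Finset.card_range, nsmul_eq_mul,
          ENNReal.ofReal_mul (by positivity), ENNReal.ofReal_natCast]
    _ ≤ _ := by
        refine Finset.sum_le_sum fun i hi => ?_
        rw [indicator_of_mem]
        rw [mem_Iic]
        refine hn2.trans ?_
        rw [← one_div_pow]
        exact pow_le_pow_of_le_one (by norm_num) (by norm_num)
          (Nat.lt_succ_iff.1 (Finset.mem_range.1 hi))

/-- The logarithmic potential of a `g`-measure is uniformly bounded. -/
lemma IsGMeasure.exists_lintegral_log_le {c : Torus} {μ : Measure Torus} (hμ : IsGMeasure c μ)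
    (hc : c ≠ 0) : ∃ K : ℝ, 0 ≤ K ∧
      ∀ z, ∫⁻ x, ENNReal.ofReal (-Real.log ‖x - z‖) ∂μ ≤ ENNReal.ofReal K := by
  obtain ⟨ρ, h0, h1, hρ⟩ := exists_birkProd_le hc
  have hl : 0 ≤ Real.log 2 := Real.log_nonneg (by norm_num)
  have hs : Summable fun i : ℕ => Real.log 2 * (ρ ^ i / ρ ^ 3) :=
    ((summable_geometric_of_lt_one h0.le h1).div_const _).mul_left _
  refine ⟨∑' i : ℕ, Real.log 2 * (ρ ^ i / ρ ^ 3), tsum_nonneg fun i => by positivity, fun z => ?_⟩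
  have hmeas : ∀ i : ℕ, Measurable fun x : Torus =>
      (Iic ((1 : ℝ) / 2 ^ i)).indicator (fun _ => ENNReal.ofReal (Real.log 2)) ‖x - z‖ := fun i =>
    (measurable_const.indicator measurableSet_Iic).comp
      (continuous_id.sub continuous_const).norm.measurable
  calc _ ≤ ∫⁻ x, ∑' i : ℕ, (Iic ((1 : ℝ) / 2 ^ i)).indicator
          (fun _ => ENNReal.ofReal (Real.log 2)) ‖x - z‖ ∂μ :=
        lintegral_mono fun x => ofReal_neg_log_le _ (norm_nonneg _)
          ((norm_le_half _).trans (by norm_num))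
    _ = ∑' i : ℕ, ∫⁻ x, (Iic ((1 : ℝ) / 2 ^ i)).indicator
          (fun _ => ENNReal.ofReal (Real.log 2)) ‖x - z‖ ∂μ :=
        lintegral_tsum fun i => (hmeas i).aemeasurable
    _ ≤ ∑' i : ℕ, ENNReal.ofReal (Real.log 2 * (ρ ^ i / ρ ^ 3)) := by
        refine ENNReal.tsum_le_tsum fun i => ?_
        have : (fun x : Torus => (Iic ((1 : ℝ) / 2 ^ i)).indicator
            (fun _ => ENNReal.ofReal (Real.log 2)) ‖x - z‖) =
            (Metric.closedBall z (1 / 2 ^ i)).indicator fun _ => ENNReal.ofReal (Real.log 2) := by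
          ext x
          simp only [indicator, mem_Iic, Metric.mem_closedBall, dist_eq_norm]
        rw [this, lintegral_indicator_const Metric.isClosed_closedBall.measurableSet,
          ENNReal.ofReal_mul hl]
        gcongr
        exact hμ.measure_closedBall_le h0 h1 hρ i z
    _ = _ := (ENNReal.ofReal_tsum_of_nonneg (fun i => by positivity) hs).symm

lemma mul_abs_cos_le {a b e e' x v r : ℝ} (hne : ∀ u ∈ Ioo e e', Real.cos (a + b * u) ≠ 0)
    (hx : x ∈ Icc e e') (hv : v ∈ Icc e e') (hr0 : 0 ≤ r) (hr1 : r ≤ 1) :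
    (1 - r) * |Real.cos (a + b * x)| ≤ |Real.cos (a + b * ((1 - r) * x + r * v))| := by
  rcases (hx.1.trans hx.2).eq_or_lt with rfl | hee
  · have h1 : x = e := le_antisymm hx.2 hx.1
    have h2 : v = e := le_antisymm hv.2 hv.1
    subst h1 h2
    have : (1 - r) * v + r * v = v := by ring
    rw [this]
    exact mul_le_of_le_one_left (abs_nonneg _) (by linarith)
  wlog hpos : ∀ u ∈ Ioo e e', 0 < Real.cos (a + b * u) generalizing a
  · have hneg : ∀ u ∈ Ioo e e', Real.cos (a + b * u) < 0 := by
      by_contra! h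
      obtain ⟨u, hu, hu0⟩ := h
      push Not at hpos
      obtain ⟨w, hw, hw0⟩ := hpos
      obtain ⟨y, hy, hy0⟩ := (isPreconnected_Ioo (a := e) (b := e')).intermediate_value hw hu
        (f := fun u => Real.cos (a + b * u)) (by fun_prop) ⟨hw0, hu0⟩
      exact hne y hy hy0
    have hsh : ∀ u, Real.cos (a + Real.pi + b * u) = -Real.cos (a + b * u) := fun u => by
      rw [add_right_comm, Real.cos_add_pi]
    have := this (a := a + Real.pi) (fun u hu => by rw [hsh]; exact neg_ne_zero.2 (hne u hu))
      (fun u hu => by rw [hsh]; linarith [hneg u hu])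
    simpa only [hsh, abs_neg] using this
  have hnn : ∀ u ∈ Icc e e', 0 ≤ Real.cos (a + b * u) := by
    intro u hu
    rw [← closure_Ioo hee.ne] at hu
    exact ContinuousWithinAt.closure_le hu continuousWithinAt_const
      (Continuous.continuousWithinAt (f := fun u => Real.cos (a + b * u)) (by fun_prop))
      fun y hy => (hpos y hy).le
  have hd : ∀ u, HasDerivAt (fun u => Real.cos (a + b * u)) (-Real.sin (a + b * u) * b) u :=
    fun u => (((hasDerivAt_id u).const_mul b).const_add a).cos.congr_deriv (by simp)
  have hd1 : deriv (fun u => Real.cos (a + b * u)) = fun u => -Real.sin (a + b * u) * b :=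
    funext fun u => (hd u).deriv
  have hd2 : ∀ u, HasDerivAt (fun u => -Real.sin (a + b * u) * b)
      (-(Real.cos (a + b * u) * b) * b) u := fun u =>
    ((((hasDerivAt_id u).const_mul b).const_add a).sin.neg.mul_const b).congr_deriv (by simp)
  have hconc : ConcaveOn ℝ (Icc e e') fun u => Real.cos (a + b * u) := by
    refine concaveOn_of_deriv2_nonpos (convex_Icc _ _) (by fun_prop)
      (fun u _ => (hd u).differentiableAt.differentiableWithinAt) ?_ ?_
    · rw [hd1]
      exact fun u _ => (hd2 u).differentiableAt.differentiableWithinAt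
    · intro u hu
      rw [Function.iterate_succ_apply', Function.iterate_one, hd1, (hd2 u).deriv]
      rw [interior_Icc] at hu
      nlinarith [hpos u hu, mul_nonneg (hpos u hu).le (mul_self_nonneg b)]
  have h := hconc.2 hx hv (sub_nonneg.2 hr1) hr0 (by ring)
  simp only [smul_eq_mul] at h
  rw [abs_of_nonneg (hnn x hx)]
  have h3 := mul_nonneg hr0 (hnn v hv)
  exact (by linarith : _ ≤ Real.cos (a + b * ((1 - r) * x + r * v))).trans (le_abs_self _)

lemma dbl_iterate_branch_sub (c : Torus) {k n : ℕ} (hk : k ≤ n) (ω : Fin n → Bool) (s : ℝ) :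
    dbl^[n - k] (dbl^[k] (branch n ω s) - antipode c) =
      (s : Torus) - dbl^[n - k] (antipode c) := by
  rw [dbl_iterate_sub, ← Function.iterate_add_apply, Nat.sub_add_cancel hk, dbl_iterate_branch]

lemma mul_gfun_le {c : Torus} {n k : ℕ} (hk : k ≤ n) (ω : Fin n → Bool) {e e' x v r : ℝ}
    (hne : ∀ u ∈ Ioo e e', ∀ j, (u : Torus) ≠ dbl^[j] (antipode c))
    (hx : x ∈ Icc e e') (hv : v ∈ Icc e e') (hr0 : 0 ≤ r) (hr1 : r ≤ 1) :
    (1 - r) ^ 2 * gfun c (dbl^[k] (branch n ω x)) ≤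
      gfun c (dbl^[k] (branch n ω ((1 - r) * x + r * v))) := by
  have hform : ∀ u : ℝ, absCos (dbl^[k] (branch n ω u) - c) =
      |Real.cos (Real.pi * (2 ^ k * wordVal n ω - rep c) + Real.pi * (2 ^ k / 2 ^ n) * u)| := by
    intro u
    have : dbl^[k] (branch n ω u) - c =
        ((2 ^ k * (wordVal n ω + u / 2 ^ n) - rep c : ℝ) : Torus) := by
      rw [AddCircle.coe_sub, coe_rep, branch, dbl_iterate_coe]
    rw [this, absCos_coe]
    congr 2
    ring
  unfold gfun
  rw [← mul_pow, hform, hform]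
  refine pow_le_pow_left₀ (mul_nonneg (by linarith) (abs_nonneg _)) ?_ 2
  refine mul_abs_cos_le (fun u hu h0 => ?_) hx hv hr0 hr1
  have hz : absCos (dbl^[k] (branch n ω u) - c) = 0 := by rw [hform, h0, abs_zero]
  rw [absCos_eq_zero_iff] at hz
  have := dbl_iterate_branch_sub c hk ω u
  rw [hz, dbl_iterate_sub, sub_self] at this
  exact hne u hu (n - k) (sub_eq_zero.1 this.symm)

lemma mul_birkProd_le {c : Torus} {n : ℕ} (ω : Fin n → Bool) {e e' x v r : ℝ}
    (hne : ∀ u ∈ Ioo e e', ∀ j, (u : Torus) ≠ dbl^[j] (antipode c))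
    (hx : x ∈ Icc e e') (hv : v ∈ Icc e e') (hr0 : 0 ≤ r) (hr1 : r ≤ 1) :
    ((1 - r) ^ 2) ^ n * birkProd c n (branch n ω x) ≤
      birkProd c n (branch n ω ((1 - r) * x + r * v)) := by
  unfold birkProd
  have hcard : ((1 - r) ^ 2) ^ n = ∏ _k ∈ Finset.range n, (1 - r) ^ 2 := by simp
  rw [hcard, ← Finset.prod_mul_distrib]
  exact Finset.prod_le_prod (fun k _ => mul_nonneg (sq_nonneg _) (gfun_nonneg _ _)) fun k hk =>
    mul_gfun_le (Finset.mem_range.1 hk).le ω hne hx hv hr0 hr1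

/-- In a finite set containing `0` and `1`, every point of `[0,1)` lies between two
consecutive elements. -/
lemma exists_consecutive {E : Set ℝ} (hE : E.Finite) (h0 : (0 : ℝ) ∈ E) (h1 : (1 : ℝ) ∈ E) {s : ℝ}
    (hs : s ∈ Ico (0 : ℝ) 1) : ∃ e ∈ E, ∃ e' ∈ E, e < e' ∧ 0 ≤ e ∧ e' ≤ 1 ∧ s ∈ Icc e e' ∧
      ∀ u ∈ Ioo e e', u ∉ E := by
  obtain ⟨e, he, hemax⟩ := (hE.inter_of_left (Iic s)).exists_maximal ⟨0, h0, hs.1⟩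
  obtain ⟨e', he', hemin⟩ := (hE.inter_of_left (Ioi s)).exists_minimal ⟨1, h1, hs.2⟩
  have hmax : ∀ u ∈ E, u ≤ s → u ≤ e := fun u hu hus => by
    by_contra! h
    exact h.not_ge (hemax ⟨hu, hus⟩ h.le)
  have hmin : ∀ u ∈ E, s < u → e' ≤ u := fun u hu hus => by
    by_contra! h
    exact h.not_ge (hemin ⟨hu, hus⟩ h.le)
  have hes : e ≤ s := he.2
  have hse : s < e' := he'.2
  refine ⟨e, he.1, e', he'.1, hes.trans_lt hse, hmax 0 h0 hs.1, hmin 1 h1 hs.2, ⟨hes, hse.le⟩,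
    fun u hu huE => ?_⟩
  rcases le_or_gt u s with h | h
  · exact (hmax u huE h).not_gt hu.1
  · exact (hmin u huE h).not_gt hu.2

/-- An estimate of `birkProd` on `[0,1)` extends to `[0,1]`. -/
lemma birkProd_branch_le_of_Ico {c : Torus} {n : ℕ} {ω : Fin n → Bool} {B : ℝ}
    (h : ∀ s ∈ Ico (0 : ℝ) 1, birkProd c n (branch n ω s) ≤ B) :
    ∀ s ∈ Icc (0 : ℝ) 1, birkProd c n (branch n ω s) ≤ B := by
  intro s hs
  rw [← closure_Ico zero_ne_one] at hs
  exact ContinuousWithinAt.closure_le hs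
    ((continuous_birkProd c n).comp (continuous_branch n ω)).continuousWithinAt
    continuousWithinAt_const h

/-- Subexponential comparison when the singularity is a periodic point. -/
lemma IsGMeasure.birkProd_le_of_periodic {c : Torus} (hc : c ≠ 0) {μ : Measure Torus}
    (hμ : IsGMeasure c μ) (hpos : ∀ (n : ℕ) (ω : Fin n → Bool), 0 < μ (cyl n ω)) {p : ℕ}
    (hp : 0 < p) (hper : dbl^[p] (antipode c) = antipode c) {ε : ℝ} (hε : 0 < ε) :
    ∃ C : ℝ, 0 < C ∧ ∀ (n : ℕ) (ω : Fin n → Bool), ∀ s ∈ Icc (0 : ℝ) 1,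
      birkProd c n (branch n ω s) ≤ C * Real.exp (ε * n) * (μ (cyl n ω)).toReal := by
  have := hμ.1
  set E : Set ℝ := {0, 1} ∪ rep '' ((fun j => dbl^[j] (antipode c)) '' Iio p) with hE
  have hEfin : E.Finite := (by simp : ({0, 1} : Set ℝ).Finite).union
    (((finite_Iio p).image _).image _)
  have h0 : (0 : ℝ) ∈ E := by simp [hE]
  have h1 : (1 : ℝ) ∈ E := by simp [hE]
  have : Finite E := hEfin
  have hγ : 0 < E.infsep := infsep_pos_iff_nontrivial_of_finite.2 ⟨0, h0, 1, h1, zero_ne_one⟩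
  set r := 1 - Real.exp (-(ε / 2)) with hr
  have hr0 : 0 < r := by
    have : Real.exp (-(ε / 2)) < 1 := by
      rw [← Real.exp_zero]
      exact Real.exp_lt_exp.2 (by linarith)
    linarith
  have hr1 : r ≤ 1 := by
    have := Real.exp_pos (-(ε / 2))
    linarith
  have hrε : ∀ n : ℕ, ((1 - r) ^ 2) ^ n = Real.exp (-(ε * n)) := fun n => by
    rw [hr, sub_sub_cancel, ← Real.exp_nat_mul, ← Real.exp_nat_mul]
    congr 1
    push_cast
    ring
  obtain ⟨m, hm⟩ := exists_pow_lt_of_lt_one (show 0 < r * E.infsep / 2 by positivity)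
    (show (1 / 2 : ℝ) < 1 by norm_num)
  rw [one_div_pow] at hm
  obtain ⟨η₀, -, hη₀⟩ := Finset.exists_min_image Finset.univ (fun η => μ (cyl m η))
    (Finset.univ_nonempty (α := Fin m → Bool))
  set δ := (μ (cyl m η₀)).toReal with hδ
  have hδ0 : 0 < δ := ENNReal.toReal_pos (hpos m η₀).ne' (measure_ne_top _ _)
  refine ⟨1 / δ, by positivity, fun n ω => birkProd_branch_le_of_Ico fun s hs => ?_⟩
  obtain ⟨e, he, e', he', hlt, he0, he1, hse, hEu⟩ := exists_consecutive hEfin h0 h1 hs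
  have hne : ∀ u ∈ Ioo e e', ∀ j, (u : Torus) ≠ dbl^[j] (antipode c) := by
    intro u hu j hj
    refine hEu u hu (Or.inr ⟨_, ⟨j % p, Nat.mod_lt _ hp, rfl⟩, ?_⟩)
    have : dbl^[j % p] (antipode c) = dbl^[j] (antipode c) :=
      Function.IsPeriodicPt.iterate_mod_apply hper j
    dsimp only
    rw [this, ← hj, rep_coe ⟨by linarith [hu.1], by linarith [hu.2]⟩]
  have hgap : E.infsep ≤ e' - e := by
    have := infsep_le_dist_of_mem he' he hlt.ne'
    rwa [Real.dist_eq, abs_of_pos (by linarith)] at this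
  set y := (1 - r) * s + r * ((e + e') / 2) with hy
  have hy0 : y ∈ Ico (0 : ℝ) 1 := by
    obtain ⟨a1, a2⟩ := hs
    constructor
    · have := mul_nonneg (sub_nonneg.2 hr1) a1
      have := mul_nonneg hr0.le (show 0 ≤ (e + e') / 2 by linarith)
      linarith
    · have := mul_le_mul_of_nonneg_left a2.le (sub_nonneg.2 hr1)
      have := mul_lt_mul_of_pos_left (show (e + e') / 2 < 1 by linarith) hr0
      linarith
  obtain ⟨η, hη⟩ := exists_branch_real m y hy0
  have hgap' := mul_le_mul_of_nonneg_left hgap hr0.le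
  have hA : ∀ x ∈ cyl m η \ {0}, Real.exp (-(ε * n)) * birkProd c n (branch n ω s) ≤
      birkProd c n (branch n ω (rep x)) := by
    rintro x ⟨⟨u, ⟨hu1, hu2⟩, rfl⟩, hx0⟩
    have b1 : (1 - r) * s + r * e ≤ u := by linarith [hη.1, hη.2]
    have b2 : u ≤ (1 - r) * s + r * e' := by linarith [hη.1, hη.2]
    have hu0 : 0 ≤ u := by
      have := mul_nonneg (sub_nonneg.2 hr1) hs.1
      have := mul_nonneg hr0.le he0
      linarith
    have hu1 : u < 1 := by
      have := mul_le_mul_of_nonneg_left hs.2.le (sub_nonneg.2 hr1)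
      have := mul_le_mul_of_nonneg_left he1 hr0.le
      refine lt_of_le_of_ne (by linarith) ?_
      rintro rfl
      exact hx0 (AddCircle.coe_period 1)
    dsimp only
    rw [rep_coe ⟨hu0, hu1⟩, ← hrε]
    have hv : (u - (1 - r) * s) / r ∈ Icc e e' :=
      ⟨by rw [le_div_iff₀ hr0]; linarith, by rw [div_le_iff₀ hr0]; linarith⟩
    have := mul_birkProd_le ω hne hse hv hr0.le hr1
    rwa [mul_div_cancel₀ _ hr0.ne', add_sub_cancel] at this
  have hle := hμ.le_measure_cyl n ω hA
  rw [measure_sdiff_null (hμ.measure_singleton hc 0)] at hle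
  have hle' := ENNReal.toReal_mono (measure_ne_top _ _) ((mul_le_mul_right
    (hη₀ η (Finset.mem_univ _)) _).trans hle)
  rw [ENNReal.toReal_mul, ENNReal.toReal_ofReal (mul_nonneg (Real.exp_nonneg _)
    (birkProd_nonneg _ _ _)), ← hδ, Real.exp_neg] at hle'
  rw [mul_assoc, one_div_mul_eq_div, le_div_iff₀ hδ0]
  have hex := Real.exp_pos (ε * n)
  calc _ = Real.exp (ε * n) * ((Real.exp (ε * n))⁻¹ * birkProd c n (branch n ω s) * δ) := by
        field_simp
    _ ≤ _ := by gcongr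

lemma card_le_of_separated {S : Finset ℕ} {n R : ℕ} (hR : 0 < R) (hS : ∀ k ∈ S, k < n)
    (hsep : ∀ k ∈ S, ∀ k' ∈ S, k < k' → R ≤ k' - k) : S.card ≤ n / R + 1 := by
  rw [← Finset.card_range (n / R + 1)]
  refine Finset.card_le_card_of_injOn (fun k => k / R) (fun k hk => ?_) fun k hk k' hk' h => ?_
  · have := Nat.div_le_div_right (c := R) (hS k hk).le
    simpa [Nat.lt_succ_iff] using this
  · have aux : ∀ a b : ℕ, a / R = b / R → b - a < R := fun a b hab => by
      have h1 := Nat.div_add_mod a R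
      have h2 := Nat.div_add_mod b R
      have h3 := Nat.mod_lt b hR
      rw [hab] at h1
      omega
    rcases lt_trichotomy k k' with hlt | heq | hlt
    · exact absurd (hsep k hk k' hk' hlt) (not_le.2 (aux _ _ h))
    · exact heq
    · exact absurd (hsep k' hk' k hk hlt) (not_le.2 (aux _ _ h.symm))

/-- The times at which the orbit of `x` is close to the singularity, relative to the length of
the corresponding cylinder. -/
def closeTimes (c : Torus) (M : ℝ) (n : ℕ) (x : Torus) : Finset ℕ :=
  {k ∈ Finset.range n | ‖dbl^[k] x - antipode c‖ ≤ M / 2 ^ (n - k)}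

lemma mem_closeTimes {c : Torus} {M : ℝ} {n : ℕ} {x : Torus} {k : ℕ} :
    k ∈ closeTimes c M n x ↔ k < n ∧ ‖dbl^[k] x - antipode c‖ ≤ M / 2 ^ (n - k) := by
  simp [closeTimes]

lemma card_closeTimes_le {c : Torus} {M δ : ℝ} (hM : 0 ≤ M) {n N R : ℕ} (hR : 0 < R)
    (hδ : ∀ p, 0 < p → p ≤ R → δ ≤ ‖dbl^[p] (antipode c) - antipode c‖)
    (hN : 2 * M / 2 ^ N < δ) (x : Torus) : (closeTimes c M n x).card ≤ N + 1 + n / R := by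
  set S := closeTimes c M n x
  have hsub : S ⊆ {k ∈ S | k + N ≤ n} ∪ Finset.Ico (n + 1 - N) n := by
    intro k hk
    have := (mem_closeTimes.1 hk).1
    simp only [Finset.mem_union, Finset.mem_filter, Finset.mem_Ico, hk, true_and]
    omega
  have h1 : ({k ∈ S | k + N ≤ n} : Finset ℕ).card ≤ n / R + 1 := by
    refine card_le_of_separated hR (fun k hk =>
      (mem_closeTimes.1 (Finset.mem_filter.1 hk).1).1) fun k hk k' hk' hlt => ?_
    by_contra! hcon
    have a1 := (mem_closeTimes.1 (Finset.mem_filter.1 hk).1).2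
    obtain ⟨a2, a3⟩ := mem_closeTimes.1 (Finset.mem_filter.1 hk').1
    have a4 := (Finset.mem_filter.1 hk').2
    have hit : dbl^[k' - k] (dbl^[k] x) = dbl^[k'] x := by
      rw [← Function.iterate_add_apply, Nat.sub_add_cancel hlt.le]
    have hpow : (2 : ℝ) ^ (n - k) = 2 ^ (k' - k) * 2 ^ (n - k') := by
      rw [← pow_add]
      congr 1
      omega
    have hb : ‖dbl^[k' - k] (antipode c) - antipode c‖ ≤ 2 * M / 2 ^ N := by
      calc ‖dbl^[k' - k] (antipode c) - antipode c‖
          = ‖(dbl^[k'] x - antipode c) - dbl^[k' - k] (dbl^[k] x - antipode c)‖ := by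
            rw [dbl_iterate_sub, hit]
            congr 1
            abel
        _ ≤ ‖dbl^[k'] x - antipode c‖ + ‖dbl^[k' - k] (dbl^[k] x - antipode c)‖ := norm_sub_le _ _
        _ ≤ M / 2 ^ (n - k') + 2 ^ (k' - k) * (M / 2 ^ (n - k)) := by
            gcongr
            exact (norm_dbl_iterate_le _ _).trans (by gcongr)
        _ = 2 * M / 2 ^ (n - k') := by
            rw [hpow]
            field_simp
            norm_num
        _ ≤ 2 * M / 2 ^ N := by
            gcongr
            · norm_num
            · omega
    exact absurd (hδ (k' - k) (by omega) hcon.le) (not_le.2 (hb.trans_lt hN))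
  calc S.card ≤ _ := Finset.card_le_card hsub
    _ ≤ _ := Finset.card_union_le _ _
    _ ≤ (n / R + 1) + N := by
        gcongr
        rw [Nat.card_Ico]
        omega
    _ = _ := by ring

lemma norm_iterate_branch_sub_le {n k : ℕ} (hk : k ≤ n) (ω : Fin n → Bool) {s u : ℝ}
    (hs : s ∈ Icc (0 : ℝ) 1) (hu : u ∈ Icc (0 : ℝ) 1) :
    ‖dbl^[k] (branch n ω s) - dbl^[k] (branch n ω u)‖ ≤ 1 / 2 ^ (n - k) := by
  have : dbl^[k] (branch n ω s) - dbl^[k] (branch n ω u) = (((s - u) / 2 ^ (n - k) : ℝ) : Torus) := by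
    rw [branch, branch, dbl_iterate_coe, dbl_iterate_coe, ← AddCircle.coe_sub]
    congr 1
    have hpow : (2 : ℝ) ^ n = 2 ^ k * 2 ^ (n - k) := by rw [← pow_add, Nat.add_sub_cancel' hk]
    rw [hpow]
    field_simp
    ring
  rw [this]
  refine (QuotientAddGroup.norm_mk_le_norm).trans ?_
  rw [Real.norm_eq_abs, abs_div, abs_of_pos (by positivity : (0 : ℝ) < 2 ^ (n - k))]
  gcongr
  rw [abs_le]
  obtain ⟨h1, h2⟩ := hs
  obtain ⟨h3, h4⟩ := hu
  constructor <;> linarith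

lemma mul_absCos_le_of_far {c : Torus} {M : ℝ} (hM : 0 < M) {n k : ℕ} (hk : k ≤ n)
    {ω : Fin n → Bool} {s u : ℝ} (hs : s ∈ Icc (0 : ℝ) 1) (hu : u ∈ Icc (0 : ℝ) 1)
    (hfar : M / 2 ^ (n - k) < ‖dbl^[k] (branch n ω s) - antipode c‖) :
    (1 - Real.pi / (2 * M)) * absCos (dbl^[k] (branch n ω s) - c) ≤
      absCos (dbl^[k] (branch n ω u) - c) := by
  have h1 := absCos_sub_absCos_le (dbl^[k] (branch n ω s) - c) (dbl^[k] (branch n ω u) - c)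
  rw [sub_sub_sub_cancel_right] at h1
  have h2 := mul_le_mul_of_nonneg_left (norm_iterate_branch_sub_le hk ω hs hu) Real.pi_pos.le
  have h3 := two_mul_norm_le_absCos c (dbl^[k] (branch n ω s))
  have h4 : Real.pi * (1 / 2 ^ (n - k)) ≤
      Real.pi / (2 * M) * absCos (dbl^[k] (branch n ω s) - c) := by
    calc Real.pi * (1 / 2 ^ (n - k)) = Real.pi / (2 * M) * (2 * (M / 2 ^ (n - k))) := by
          field_simp
      _ ≤ _ := by
          have := Real.pi_pos
          gcongr
          linarith
  linarith

lemma mul_absCos_le_of_near {c : Torus} {M : ℝ} (hM : 0 < M) {n k : ℕ} (hk : k ≤ n)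
    {ω : Fin n → Bool} {s u : ℝ}
    (hnear : ‖dbl^[k] (branch n ω s) - antipode c‖ ≤ M / 2 ^ (n - k)) :
    2 / (Real.pi * M) * ‖(u : Torus) - dbl^[n - k] (antipode c)‖ *
      absCos (dbl^[k] (branch n ω s) - c) ≤ absCos (dbl^[k] (branch n ω u) - c) := by
  have hpi := Real.pi_pos
  have h1 := absCos_le_pi_mul_norm c (dbl^[k] (branch n ω s))
  have h2 := two_mul_norm_le_absCos c (dbl^[k] (branch n ω u))
  have h3 := norm_dbl_iterate_le (n - k) (dbl^[k] (branch n ω u) - antipode c)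
  rw [dbl_iterate_branch_sub c hk] at h3
  calc _ ≤ 2 / (Real.pi * M) * (2 ^ (n - k) * ‖dbl^[k] (branch n ω u) - antipode c‖) *
        (Real.pi * (M / 2 ^ (n - k))) := by
        gcongr
        · exact absCos_nonneg _
        · exact h1.trans (by gcongr)
    _ = 2 * ‖dbl^[k] (branch n ω u) - antipode c‖ := by field_simp
    _ ≤ _ := h2

/-- Pointwise comparison of `birkProd` at two points of a cylinder. -/
lemma mul_birkProd_le_of_card {c : Torus} {M κ l : ℝ} (hM : 0 < M) (hκ : κ = 1 - Real.pi / (2 * M))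
    (hκ0 : 0 ≤ κ) (hl : l = 2 / (Real.pi * M)) (hl1 : l ≤ 1) {n B : ℕ} {ω : Fin n → Bool}
    {s u : ℝ} (hs : s ∈ Icc (0 : ℝ) 1) (hu : u ∈ Icc (0 : ℝ) 1)
    (hB : (closeTimes c M n (branch n ω s)).card ≤ B) :
    (κ ^ n * (l ^ B * ∏ k ∈ closeTimes c M n (branch n ω s),
      ‖(u : Torus) - dbl^[n - k] (antipode c)‖)) ^ 2 * birkProd c n (branch n ω s) ≤
      birkProd c n (branch n ω u) := by
  have hpi := Real.pi_pos
  have hl0 : 0 ≤ l := by rw [hl]; positivity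
  have hκ1 : κ ≤ 1 := by
    have : 0 < Real.pi / (2 * M) := by positivity
    linarith
  set S := closeTimes c M n (branch n ω s) with hS
  set w : ℕ → ℝ := fun k => κ * if ‖dbl^[k] (branch n ω s) - antipode c‖ ≤ M / 2 ^ (n - k) then
    l * ‖(u : Torus) - dbl^[n - k] (antipode c)‖ else 1 with hw
  have hw0 : ∀ k, 0 ≤ w k := fun k => by
    simp only [hw]
    split_ifs <;> positivity
  have hprod : κ ^ n * (l ^ S.card * ∏ k ∈ S, ‖(u : Torus) - dbl^[n - k] (antipode c)‖) =
      ∏ k ∈ Finset.range n, w k := by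
    simp only [hw]
    rw [Finset.prod_mul_distrib, ← Finset.prod_filter, Finset.prod_mul_distrib]
    simp [hS, closeTimes]
  have hle : κ ^ n * (l ^ B * ∏ k ∈ S, ‖(u : Torus) - dbl^[n - k] (antipode c)‖) ≤
      ∏ k ∈ Finset.range n, w k := by
    rw [← hprod]
    have : 0 ≤ ∏ k ∈ S, ‖(u : Torus) - dbl^[n - k] (antipode c)‖ :=
      Finset.prod_nonneg fun _ _ => norm_nonneg _
    gcongr κ ^ n * (?_ * _)
    exact pow_le_pow_of_le_one hl0 hl1 hB
  calc _ ≤ (∏ k ∈ Finset.range n, w k) ^ 2 * birkProd c n (branch n ω s) := by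
        have : 0 ≤ ∏ k ∈ S, ‖(u : Torus) - dbl^[n - k] (antipode c)‖ :=
          Finset.prod_nonneg fun _ _ => norm_nonneg _
        gcongr
        exact birkProd_nonneg _ _ _
    _ = ∏ k ∈ Finset.range n, (w k * absCos (dbl^[k] (branch n ω s) - c)) ^ 2 := by
        simp only [mul_pow, Finset.prod_mul_distrib, Finset.prod_pow]
        rw [birkProd]
        simp only [gfun, Finset.prod_pow]
    _ ≤ _ := by
        refine Finset.prod_le_prod (fun k _ => sq_nonneg _) fun k hk => ?_
        have hk' := (Finset.mem_range.1 hk).le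
        refine pow_le_pow_left₀ (mul_nonneg (hw0 k) (absCos_nonneg _)) ?_ 2
        simp only [hw]
        have hA := absCos_nonneg (dbl^[k] (branch n ω s) - c)
        split_ifs with h
        · refine le_trans ?_ (mul_absCos_le_of_near hM hk' h)
          rw [← hl, mul_assoc]
          exact mul_le_of_le_one_left (by positivity) hκ1
        · rw [mul_one, hκ]
          exact mul_absCos_le_of_far hM hk' hs hu (not_le.1 h)

/-- Most points are not too close, on average, to a given finite family of points. -/
lemma half_le_measure_prod_norm {μ : Measure Torus} [IsProbabilityMeasure μ] {K : ℝ} (hK : 0 < K)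
    (hatom : ∀ y, μ {y} = 0)
    (hlog : ∀ z, ∫⁻ x, ENNReal.ofReal (-Real.log ‖x - z‖) ∂μ ≤ ENNReal.ofReal K)
    (S : Finset ℕ) (z : ℕ → Torus) {B : ℕ} (hB0 : 0 < B) (hB : S.card ≤ B) :
    1 / 2 ≤ μ {x | Real.exp (-(2 * K)) ^ B ≤ ∏ k ∈ S, ‖x - z k‖} := by
  set H : Torus → ℝ≥0∞ := fun x => ∑ k ∈ S, ENNReal.ofReal (-Real.log ‖x - z k‖) with hH
  have hmk : ∀ k, Measurable fun x => ENNReal.ofReal (-Real.log ‖x - z k‖) := fun k =>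
    (Real.measurable_log.comp (continuous_id.sub continuous_const).norm.measurable).neg.ennreal_ofReal
  have hHm : Measurable H := Finset.measurable_fun_sum _ fun k _ => hmk k
  set V := 2 * (K * B) with hV
  have hBpos : (0 : ℝ) < B := by exact_mod_cast hB0
  have hV0 : 0 < V := by positivity
  have hintegral : ∫⁻ x, H x ∂μ ≤ ENNReal.ofReal (K * B) := by
    rw [hH, lintegral_finsetSum _ fun k _ => hmk k]
    calc _ ≤ ∑ _k ∈ S, ENNReal.ofReal K := Finset.sum_le_sum fun k _ => hlog _
      _ = S.card * ENNReal.ofReal K := by rw [Finset.sum_const, nsmul_eq_mul]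
      _ ≤ B * ENNReal.ofReal K := by gcongr
      _ = _ := by rw [mul_comm K, ENNReal.ofReal_mul hBpos.le, ENNReal.ofReal_natCast]
  have hmarkov : μ {x | ENNReal.ofReal V ≤ H x} ≤ 1 / 2 := by
    refine (meas_ge_le_lintegral_div hHm.aemeasurable (ENNReal.ofReal_pos.2 hV0).ne'
      ENNReal.ofReal_ne_top).trans ((ENNReal.div_le_div_right hintegral _).trans (le_of_eq ?_))
    rw [← ENNReal.ofReal_div_of_pos hV0, hV]
    have : K * B / (2 * (K * B)) = 1 / 2 := by field_simp
    rw [this, ENNReal.ofReal_div_of_pos two_pos]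
    simp
  have hcover : (univ : Set Torus) ⊆ {x | ENNReal.ofReal V ≤ H x} ∪ (z '' S) ∪
      {x | Real.exp (-(2 * K)) ^ B ≤ ∏ k ∈ S, ‖x - z k‖} := by
    intro x _
    by_cases h1 : ENNReal.ofReal V ≤ H x
    · exact Or.inl (Or.inl h1)
    by_cases h2 : x ∈ z '' S
    · exact Or.inl (Or.inr h2)
    refine Or.inr ?_
    have hne : ∀ k ∈ S, 0 < ‖x - z k‖ := fun k hk =>
      norm_pos_iff.2 (sub_ne_zero.2 fun h => h2 ⟨k, hk, h.symm⟩)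
    have hlog0 : ∀ k ∈ S, 0 ≤ -Real.log ‖x - z k‖ := fun k _ =>
      neg_nonneg.2 (Real.log_nonpos (norm_nonneg _) ((norm_le_half _).trans (by norm_num)))
    have hsum : ∑ k ∈ S, -Real.log ‖x - z k‖ ≤ V := by
      rw [not_le, hH] at h1
      dsimp only at h1
      rw [← ENNReal.ofReal_sum_of_nonneg hlog0] at h1
      exact ((ENNReal.ofReal_lt_ofReal_iff hV0).1 h1).le
    change Real.exp (-(2 * K)) ^ B ≤ ∏ k ∈ S, ‖x - z k‖
    have : ∏ k ∈ S, ‖x - z k‖ = Real.exp (-∑ k ∈ S, -Real.log ‖x - z k‖) := by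
      rw [Finset.sum_neg_distrib, neg_neg, Real.exp_sum]
      exact Finset.prod_congr rfl fun k hk => (Real.exp_log (hne k hk)).symm
    rw [this, ← Real.exp_nat_mul, Real.exp_le_exp]
    linarith
  have hnull : μ (z '' S) = 0 := by
    rw [← biUnion_of_singleton (z '' S)]
    exact (measure_biUnion_null_iff (S.finite_toSet.image z).countable).2 fun y _ => hatom y
  have h1 : (1 : ℝ≥0∞) ≤ 1 / 2 + μ {x | Real.exp (-(2 * K)) ^ B ≤ ∏ k ∈ S, ‖x - z k‖} := by
    calc (1 : ℝ≥0∞) = μ univ := measure_univ.symm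
      _ ≤ _ := measure_mono hcover
      _ ≤ _ := measure_union_le _ _
      _ ≤ μ {x | ENNReal.ofReal V ≤ H x} + μ (z '' S) + _ := by
          gcongr
          exact measure_union_le _ _
      _ ≤ _ := by
          rw [hnull, add_zero]
          gcongr
  refine ENNReal.le_of_add_le_add_left (a := 1 / 2) (by simp) ?_
  rwa [ENNReal.add_halves]

/-- Subexponential comparison when the singularity is not a periodic point. -/
lemma IsGMeasure.birkProd_le_of_not_periodic {c : Torus} (hc : c ≠ 0) {μ : Measure Torus}
    (hμ : IsGMeasure c μ) (hper : ∀ p, 0 < p → dbl^[p] (antipode c) ≠ antipode c)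
    {ε : ℝ} (hε : 0 < ε) :
    ∃ C : ℝ, 0 < C ∧ ∀ (n : ℕ) (ω : Fin n → Bool), ∀ s ∈ Icc (0 : ℝ) 1,
      birkProd c n (branch n ω s) ≤ C * Real.exp (ε * n) * (μ (cyl n ω)).toReal := by
  have := hμ.1
  have hpi := Real.pi_gt_three
  set κ := Real.exp (-(ε / 4)) with hκdef
  have hκ0 : 0 < κ := Real.exp_pos _
  have hκ1 : κ < 1 := by
    rw [← Real.exp_zero]
    exact Real.exp_lt_exp.2 (by linarith)
  set M := Real.pi / (2 * (1 - κ)) with hMdef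
  have h1κ : 0 < 1 - κ := by linarith
  have hM : 0 < M := by positivity
  have hκ : κ = 1 - Real.pi / (2 * M) := by
    rw [hMdef]
    field_simp
    ring
  have hM1 : 1 ≤ M := by
    rw [hMdef, one_le_div (by positivity)]
    linarith
  set l := 2 / (Real.pi * M) with hl
  have hl0 : 0 < l := by positivity
  have hl1 : l ≤ 1 := by
    rw [hl, div_le_one (by positivity)]
    nlinarith
  obtain ⟨K', hK'0, hK'⟩ := hμ.exists_lintegral_log_le hc
  set K := K' + 1 with hKdef
  have hK : 0 < K := by positivity
  have hlog : ∀ z, ∫⁻ x, ENNReal.ofReal (-Real.log ‖x - z‖) ∂μ ≤ ENNReal.ofReal K := fun z =>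
    (hK' z).trans (ENNReal.ofReal_le_ofReal (by linarith))
  set L := l * Real.exp (-(2 * K)) with hL
  have hL0 : 0 < L := by positivity
  obtain ⟨R, hR⟩ := exists_nat_ge (-Real.log L / (ε / 4))
  replace hR : -Real.log L ≤ ε / 4 * (R + 1 : ℕ) := by
    rw [div_le_iff₀ (by positivity)] at hR
    push_cast
    linarith
  set R' := R + 1
  have hR0 : 0 < R' := Nat.succ_pos R
  obtain ⟨p₀, hp₀, hmin⟩ := Finset.exists_min_image (Finset.Icc 1 R')
    (fun p => ‖dbl^[p] (antipode c) - antipode c‖) ⟨1, Finset.mem_Icc.2 ⟨le_rfl, hR0⟩⟩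
  set δ := ‖dbl^[p₀] (antipode c) - antipode c‖ with hδ
  have hδ0 : 0 < δ := norm_pos_iff.2 (sub_ne_zero.2 (hper p₀ (Finset.mem_Icc.1 hp₀).1))
  obtain ⟨N, hN⟩ := exists_pow_lt_of_lt_one (show 0 < δ / (2 * M) by positivity)
    (show (1 / 2 : ℝ) < 1 by norm_num)
  have hN' : 2 * M / 2 ^ N < δ := by
    rw [lt_div_iff₀ (by positivity), one_div_pow] at hN
    calc _ = 1 / 2 ^ N * (2 * M) := by ring
      _ < δ := hN
  refine ⟨2 / (L ^ (N + 1)) ^ 2, by positivity, fun n ω s hs => ?_⟩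
  set S := closeTimes c M n (branch n ω s)
  set B := N + 1 + n / R' with hB
  have hcard : S.card ≤ B := card_closeTimes_le hM.le hR0
    (fun p hp hpR => hmin p (Finset.mem_Icc.2 ⟨hp, hpR⟩)) hN' _
  have hmeas := half_le_measure_prod_norm hK (hμ.measure_singleton hc) hlog S
    (fun k => dbl^[n - k] (antipode c)) (Nat.add_pos_left N.succ_pos _) hcard
  have hbound : ∀ x ∈ {x | Real.exp (-(2 * K)) ^ B ≤ ∏ k ∈ S, ‖x - dbl^[n - k] (antipode c)‖},
      (κ ^ n * L ^ B) ^ 2 * birkProd c n (branch n ω s) ≤ birkProd c n (branch n ω (rep x)) := by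
    intro x hx
    have := mul_birkProd_le_of_card hM hκ hκ0.le hl hl1 hs
      ⟨(rep_mem x).1, (rep_mem x).2.le⟩ hcard
    refine le_trans ?_ this
    have := birkProd_nonneg c n (branch n ω s)
    rw [coe_rep, hL, mul_pow l]
    gcongr
    exact hx
  have hle := hμ.le_measure_cyl n ω hbound
  have hle' := ENNReal.toReal_mono (measure_ne_top _ _) ((mul_le_mul_right hmeas _).trans hle)
  rw [ENNReal.toReal_mul, ENNReal.toReal_ofReal (mul_nonneg (sq_nonneg _)
    (birkProd_nonneg _ _ _))] at hle'
  simp only [one_div, ENNReal.toReal_inv, ENNReal.toReal_ofNat] at hle'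
  have hlow : Real.exp (-(ε * n)) * (L ^ (N + 1)) ^ 2 ≤ (κ ^ n * L ^ B) ^ 2 := by
    have h1 : κ ^ n = Real.exp (-(ε / 4 * n)) := by
      rw [hκdef, ← Real.exp_nat_mul]
      congr 1
      ring
    have h2 : Real.exp (-(ε / 4 * n)) ≤ L ^ (n / R') := by
      rw [← Real.exp_log hL0, ← Real.exp_nat_mul, Real.exp_le_exp]
      have h3 : ((n / R' : ℕ) : ℝ) * R' ≤ n := by exact_mod_cast Nat.div_mul_le_self n R'
      have h4 := mul_le_mul_of_nonneg_left hR (Nat.cast_nonneg (α := ℝ) (n / R'))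
      have h5 := mul_le_mul_of_nonneg_left h3 (show 0 ≤ ε / 4 by positivity)
      nlinarith
    have h6 : Real.exp (-(ε * n)) = (Real.exp (-(ε / 4 * n)) * Real.exp (-(ε / 4 * n))) ^ 2 := by
      rw [← Real.exp_add, ← Real.exp_nat_mul]
      congr 1
      push_cast
      ring
    have hLB : L ^ B = L ^ (n / R') * L ^ (N + 1) := by rw [hB, pow_add _ (N + 1), mul_comm]
    rw [h6, ← mul_pow, h1, hLB, ← mul_assoc]
    gcongr
  have hb := birkProd_nonneg c n (branch n ω s)
  have h7 : Real.exp (-(ε * n)) * (L ^ (N + 1)) ^ 2 * birkProd c n (branch n ω s) ≤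
      2 * (μ (cyl n ω)).toReal := by
    have := mul_le_mul_of_nonneg_right hlow hb
    linarith
  rw [Real.exp_neg] at h7
  have hex := Real.exp_pos (ε * n)
  calc birkProd c n (branch n ω s) = Real.exp (ε * n) / (L ^ (N + 1)) ^ 2 *
        ((Real.exp (ε * n))⁻¹ * (L ^ (N + 1)) ^ 2 * birkProd c n (branch n ω s)) := by field_simp
    _ ≤ Real.exp (ε * n) / (L ^ (N + 1)) ^ 2 * (2 * (μ (cyl n ω)).toReal) := by gcongr
    _ = _ := by ring

lemma log_sum_rpow_le {ι : Type*} [Fintype ι] [Nonempty ι] {a b : ι → ℝ} (ha : ∀ i, 0 < a i)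
    (hb : ∀ i, 0 < b i) {D : ℝ} (hD : ∀ i, |Real.log (a i) - Real.log (b i)| ≤ D) (t : ℝ) :
    Real.log (∑ i, a i ^ t) - Real.log (∑ i, b i ^ t) ≤ |t| * D := by
  have hsa : 0 < ∑ i, a i ^ t :=
    Finset.sum_pos (fun i _ => Real.rpow_pos_of_pos (ha i) t) Finset.univ_nonempty
  have hsb : 0 < ∑ i, b i ^ t :=
    Finset.sum_pos (fun i _ => Real.rpow_pos_of_pos (hb i) t) Finset.univ_nonempty
  have key : ∑ i, a i ^ t ≤ Real.exp (|t| * D) * ∑ i, b i ^ t := by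
    rw [Finset.mul_sum]
    refine Finset.sum_le_sum fun i _ => ?_
    rw [Real.rpow_def_of_pos (ha i), Real.rpow_def_of_pos (hb i), ← Real.exp_add,
      Real.exp_le_exp]
    have h1 : (Real.log (a i) - Real.log (b i)) * t ≤ |t| * D := by
      calc _ ≤ |(Real.log (a i) - Real.log (b i)) * t| := le_abs_self _
        _ = |t| * |Real.log (a i) - Real.log (b i)| := by rw [abs_mul, mul_comm]
        _ ≤ |t| * D := mul_le_mul_of_nonneg_left (hD i) (abs_nonneg t)
    linarith
  have := Real.log_le_log hsa key
  rw [Real.log_mul (Real.exp_pos _).ne' hsb.ne', Real.log_exp] at this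
  linarith

lemma abs_log_sum_rpow_sub_le {ι : Type*} [Fintype ι] [Nonempty ι] {a b : ι → ℝ}
    (ha : ∀ i, 0 < a i) (hb : ∀ i, 0 < b i) {D : ℝ}
    (hD : ∀ i, |Real.log (a i) - Real.log (b i)| ≤ D) (t : ℝ) :
    |Real.log (∑ i, a i ^ t) - Real.log (∑ i, b i ^ t)| ≤ |t| * D := by
  rw [abs_le]
  have h := log_sum_rpow_le hb ha (fun i => by rw [abs_sub_comm]; exact hD i) t
  exact ⟨by linarith, log_sum_rpow_le ha hb hD t⟩

lemma limsup_coe_le_of_tendsto_sub {u v : ℕ → ℝ} (h : Tendsto (fun n => u n - v n) atTop (𝓝 0)) :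
    limsup (fun n => (u n : EReal)) atTop ≤ limsup (fun n => (v n : EReal)) atTop := by
  have h0 : limsup (fun n => ((u n - v n : ℝ) : EReal)) atTop = 0 :=
    (EReal.tendsto_coe.2 h).limsup_eq
  have := EReal.limsup_add_le (f := atTop) (u := fun n => (v n : EReal))
    (v := fun n => ((u n - v n : ℝ) : EReal)) (Or.inr (by rw [h0]; exact EReal.zero_ne_top))
    (Or.inr (by rw [h0]; exact EReal.zero_ne_bot))
  rw [h0, add_zero] at this
  refine le_trans (le_of_eq ?_) this
  congr 1
  funext n
  rw [Pi.add_apply, ← EReal.coe_add, add_sub_cancel]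

lemma liminf_coe_le_of_tendsto_sub {u v : ℕ → ℝ} (h : Tendsto (fun n => u n - v n) atTop (𝓝 0)) :
    liminf (fun n => (v n : EReal)) atTop ≤ liminf (fun n => (u n : EReal)) atTop := by
  have h0 : liminf (fun n => ((u n - v n : ℝ) : EReal)) atTop = 0 :=
    (EReal.tendsto_coe.2 h).liminf_eq
  have := EReal.le_liminf_add (f := atTop) (u := fun n => (v n : EReal))
    (v := fun n => ((u n - v n : ℝ) : EReal))
  rw [h0, add_zero] at this
  refine this.trans (le_of_eq ?_)
  congr 1
  funext n
  rw [Pi.add_apply, ← EReal.coe_add, add_sub_cancel]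

/-- Subexponential comparison of the Birkhoff products with the measure of cylinders. -/
lemma IsGMeasure.birkProd_le {c : Torus} (hc : c ≠ 0) {μ : Measure Torus}
    (hμ : IsGMeasure c μ) (hpos : ∀ (n : ℕ) (ω : Fin n → Bool), 0 < μ (cyl n ω))
    {ε : ℝ} (hε : 0 < ε) :
    ∃ C : ℝ, 0 < C ∧ ∀ (n : ℕ) (ω : Fin n → Bool), ∀ y ∈ cyl n ω,
      birkProd c n y ≤ C * Real.exp (ε * n) * (μ (cyl n ω)).toReal := by
  obtain ⟨C, hC, h⟩ : ∃ C : ℝ, 0 < C ∧ ∀ (n : ℕ) (ω : Fin n → Bool), ∀ s ∈ Icc (0 : ℝ) 1,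
      birkProd c n (branch n ω s) ≤ C * Real.exp (ε * n) * (μ (cyl n ω)).toReal := by
    by_cases hper : ∃ p, 0 < p ∧ dbl^[p] (antipode c) = antipode c
    · obtain ⟨p, hp, hper⟩ := hper
      exact hμ.birkProd_le_of_periodic hc hpos hp hper hε
    · push Not at hper
      exact hμ.birkProd_le_of_not_periodic hc hper hε
  refine ⟨C, hC, fun n ω y hy => ?_⟩
  obtain ⟨s, hs, rfl⟩ := exists_branch_of_mem_cyl hy
  exact h n ω s hs

lemma exists_birkProd_max (c : Torus) (n : ℕ) (ω : Fin n → Bool) :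
    ∃ y ∈ cyl n ω, ∀ x ∈ cyl n ω, birkProd c n x ≤ birkProd c n y := by
  obtain ⟨y, hy, hmax⟩ := (isCompact_cyl n ω).exists_isMaxOn
    ⟨_, branch_mem_cyl n ω ⟨le_rfl, zero_le_one⟩⟩ (continuous_birkProd c n).continuousOn
  exact ⟨y, hy, hmax⟩

/-- The maximum of the Birkhoff product over a cylinder. -/
def cylMax (c : Torus) (n : ℕ) (ω : Fin n → Bool) : ℝ :=
  birkProd c n (exists_birkProd_max c n ω).choose

lemma birkProd_le_cylMax (c : Torus) (n : ℕ) (ω : Fin n → Bool) {x : Torus} (hx : x ∈ cyl n ω) :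
    birkProd c n x ≤ cylMax c n ω :=
  (exists_birkProd_max c n ω).choose_spec.2 x hx

lemma IsGMeasure.measure_cyl_le_cylMax {c : Torus} {μ : Measure Torus} (hμ : IsGMeasure c μ)
    (n : ℕ) (ω : Fin n → Bool) : μ (cyl n ω) ≤ 2 * ENNReal.ofReal (cylMax c n ω) :=
  hμ.measure_cyl_le n ω fun _ hy => birkProd_le_cylMax c n ω hy

lemma IsGMeasure.cylMax_pos {c : Torus} {μ : Measure Torus} (hμ : IsGMeasure c μ)
    (hpos : ∀ (n : ℕ) (ω : Fin n → Bool), 0 < μ (cyl n ω)) (n : ℕ) (ω : Fin n → Bool) :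
    0 < cylMax c n ω := by
  by_contra h
  have := (hpos n ω).trans_le (hμ.measure_cyl_le_cylMax n ω)
  rw [ENNReal.ofReal_of_nonpos (not_lt.1 h), mul_zero] at this
  exact lt_irrefl _ this

lemma psi_eq_log {c x : Torus} (h : gfun c x ≠ 0) : psi c x = (Real.log (gfun c x) : ℝ) := by
  have h' : absCos (x - c) ≠ 0 := fun h0 => h (by simp [gfun, h0])
  rw [psi, if_neg h', gfun, Real.log_pow]
  norm_cast

lemma psiSum_eq_log {c : Torus} {n : ℕ} {x : Torus} (h : 0 < birkProd c n x) :
    psiSum c n x = (Real.log (birkProd c n x) : ℝ) := by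
  have h' : ∀ k ∈ Finset.range n, gfun c (dbl^[k] x) ≠ 0 := Finset.prod_ne_zero_iff.1 h.ne'
  rw [birkProd, Real.log_prod h', psiSum, Finset.sum_congr rfl fun k hk => psi_eq_log (h' k hk)]
  exact (map_sum (⟨⟨fun r : ℝ => (r : EReal), EReal.coe_zero⟩, EReal.coe_add⟩ : ℝ →+ EReal) _ _).symm

lemma psiSum_eq_bot {c : Torus} {n : ℕ} {x : Torus} (h : birkProd c n x = 0) :
    psiSum c n x = ⊥ := by
  obtain ⟨k, hk, h0⟩ := Finset.prod_eq_zero_iff.1 h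
  have hpsi : psi c (dbl^[k] x) = ⊥ := by
    rw [psi, if_pos (pow_eq_zero_iff two_ne_zero |>.1 h0)]
  rw [psiSum, ← Finset.add_sum_erase _ _ hk, hpsi, EReal.bot_add]

lemma iSup_psiSum {c : Torus} {n : ℕ} {ω : Fin n → Bool} (h : 0 < cylMax c n ω) :
    ⨆ x ∈ cyl n ω, psiSum c n x = (Real.log (cylMax c n ω) : ℝ) := by
  refine le_antisymm (iSup₂_le fun x hx => ?_) ?_
  · rcases (birkProd_nonneg c n x).eq_or_lt with h0 | h0
    · rw [psiSum_eq_bot h0.symm]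
      exact bot_le
    · rw [psiSum_eq_log h0, EReal.coe_le_coe_iff]
      exact Real.log_le_log h0 (birkProd_le_cylMax c n ω hx)
  · rw [cylMax, ← psiSum_eq_log h]
    exact le_iSup₂ (f := fun x (_ : x ∈ cyl n ω) => psiSum c n x) _
      (exists_birkProd_max c n ω).choose_spec.1

lemma presZ_eq {c : Torus} {n : ℕ} (h : ∀ ω, 0 < cylMax c n ω) (t : ℝ) :
    presZ c t n = ENNReal.ofReal (∑ ω, cylMax c n ω ^ t) := by
  rw [presZ, ENNReal.ofReal_sum_of_nonneg fun ω _ => Real.rpow_nonneg (h ω).le t]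
  refine Finset.sum_congr rfl fun ω _ => ?_
  rw [iSup_psiSum (h ω), ← EReal.coe_mul, eexp, if_neg (EReal.coe_ne_bot _),
    if_neg (EReal.coe_ne_top _), EReal.toReal_coe, Real.rpow_def_of_pos (h ω), mul_comm]

lemma elog_presZ {c : Torus} {n : ℕ} (h : ∀ ω, 0 < cylMax c n ω) (t : ℝ) :
    elog (presZ c t n) = (Real.log (∑ ω, cylMax c n ω ^ t) : ℝ) := by
  have hs : 0 < ∑ ω, cylMax c n ω ^ t :=
    Finset.sum_pos (fun ω _ => Real.rpow_pos_of_pos (h ω) t) Finset.univ_nonempty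
  rw [presZ_eq h, elog, if_neg (ENNReal.ofReal_pos.2 hs).ne', if_neg ENNReal.ofReal_ne_top,
    ENNReal.toReal_ofReal hs.le]

lemma IsGMeasure.abs_log_measure_sub_le {c : Torus} (hc : c ≠ 0) {μ : Measure Torus}
    (hμ : IsGMeasure c μ) (hpos : ∀ (n : ℕ) (ω : Fin n → Bool), 0 < μ (cyl n ω))
    {ε : ℝ} (hε : 0 < ε) :
    ∃ C : ℝ, ∀ (n : ℕ) (ω : Fin n → Bool),
      |Real.log (μ (cyl n ω)).toReal - Real.log (cylMax c n ω)| ≤ ε * n + C := by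
  have := hμ.1
  obtain ⟨C, hC, h⟩ := hμ.birkProd_le hc hpos hε
  refine ⟨|Real.log C| + Real.log 2, fun n ω => ?_⟩
  have hM := hμ.cylMax_pos hpos n ω
  have hm : 0 < (μ (cyl n ω)).toReal := ENNReal.toReal_pos (hpos n ω).ne' (measure_ne_top _ _)
  have h1 : cylMax c n ω ≤ C * Real.exp (ε * n) * (μ (cyl n ω)).toReal :=
    h n ω _ (exists_birkProd_max c n ω).choose_spec.1
  have h2 : (μ (cyl n ω)).toReal ≤ 2 * cylMax c n ω := by
    have := ENNReal.toReal_mono (by finiteness) (hμ.measure_cyl_le_cylMax n ω)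
    rwa [ENNReal.toReal_mul, ENNReal.toReal_ofReal hM.le, ENNReal.toReal_ofNat] at this
  have h3 := Real.log_le_log hM h1
  have h4 := Real.log_le_log hm h2
  rw [Real.log_mul (by positivity) hm.ne', Real.log_mul hC.ne' (Real.exp_pos _).ne',
    Real.log_exp] at h3
  rw [Real.log_mul two_ne_zero hM.ne'] at h4
  have h5 := le_abs_self (Real.log C)
  have h6 := abs_nonneg (Real.log C)
  have h7 : 0 < Real.log 2 := Real.log_pos one_lt_two
  have h8 : 0 ≤ ε * n := by positivity
  rw [abs_le]
  constructor <;> linarith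

lemma IsGMeasure.tendsto_sub {c : Torus} (hc : c ≠ 0) {μ : Measure Torus}
    (hμ : IsGMeasure c μ) (hpos : ∀ (n : ℕ) (ω : Fin n → Bool), 0 < μ (cyl n ω)) (t : ℝ) :
    Tendsto (fun n : ℕ => (n : ℝ)⁻¹ * Real.log (lqSum μ t n) -
      (n : ℝ)⁻¹ * Real.log (∑ ω, cylMax c n ω ^ t)) atTop (𝓝 0) := by
  have := hμ.1
  rw [Metric.tendsto_atTop]
  intro η hη
  set ε := η / (2 * (|t| + 1)) with hεdef
  have ht := abs_nonneg t
  have hε : 0 < ε := by positivity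
  obtain ⟨C, hC⟩ := hμ.abs_log_measure_sub_le hc hpos hε
  obtain ⟨N, hN⟩ := exists_nat_gt (|t| * C / (η / 2))
  refine ⟨N + 1, fun n hn => ?_⟩
  have hn0 : (0 : ℝ) < n := by exact_mod_cast (Nat.succ_pos N).trans_le hn
  have hNn : (N : ℝ) ≤ n := by exact_mod_cast (Nat.le_succ N).trans hn
  rw [div_lt_iff₀ (by positivity)] at hN
  have h1 := abs_log_sum_rpow_sub_le
    (fun ω => ENNReal.toReal_pos (hpos n ω).ne' (measure_ne_top _ _))
    (fun ω => hμ.cylMax_pos hpos n ω) (hC n) t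
  have h2 : |t| * ε ≤ η / 2 := by
    rw [hεdef, mul_div_assoc', div_le_div_iff₀ (by positivity) two_pos]
    nlinarith
  have h3 : |t| * (ε * n + C) < η * n := by
    nlinarith [mul_le_mul_of_nonneg_right h2 hn0.le, mul_le_mul_of_nonneg_right hNn hη.le]
  rw [Real.dist_eq, sub_zero, ← mul_sub, abs_mul, abs_of_pos (inv_pos.2 hn0), inv_mul_lt_iff₀ hn0,
    mul_comm (n : ℝ)]
  exact h1.trans_lt h3

/-- for `c ≠ 0` and a fully supported `g`-measure `μ` for `g^c`,
`log 2 · β̄_μ(t) = P̄_top(t ψ^c)` and `log 2 · β̲_μ(t) = P̲_top(t ψ^c)` for all `t ∈ ℝ`. -/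
theorem stmt4 (c : Torus) (hc : c ≠ 0) (μ : Measure Torus) (hμ : IsGMeasure c μ)
    (hpos : ∀ (n : ℕ) (ω : Fin n → Bool), 0 < μ (cyl n ω)) (t : ℝ) :
    ((Real.log 2 : ℝ) : EReal) * lqUpper μ t = presUpper c t ∧
      ((Real.log 2 : ℝ) : EReal) * lqLower μ t = presLower c t := by
  have h2 : 0 < Real.log 2 := Real.log_pos one_lt_two
  have h2' : (0 : EReal) ≤ (Real.log 2 : ℝ) := EReal.coe_nonneg.2 h2.le
  have hlq : ∀ n : ℕ, ((Real.log 2 : ℝ) : EReal) *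
      ((((n : ℝ) * Real.log 2)⁻¹ * Real.log (lqSum μ t n) : ℝ) : EReal) =
      (((n : ℝ)⁻¹ * Real.log (lqSum μ t n) : ℝ) : EReal) := fun n => by
    rw [← EReal.coe_mul]
    congr 1
    rw [mul_inv]
    field_simp
  have hpres : ∀ n : ℕ, (((n : ℝ)⁻¹ : ℝ) : EReal) * elog (presZ c t n) =
      (((n : ℝ)⁻¹ * Real.log (∑ ω, cylMax c n ω ^ t) : ℝ) : EReal) := fun n => by
    rw [elog_presZ (hμ.cylMax_pos hpos n), EReal.coe_mul]
  have hlim := hμ.tendsto_sub hc hpos t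
  have hlim' := hlim.neg
  simp only [neg_sub, neg_zero] at hlim'
  rw [lqUpper, lqLower, presUpper, presLower,
    ← EReal.limsup_const_mul_of_nonneg_of_ne_top h2' (EReal.coe_ne_top _),
    ← EReal.liminf_const_mul_of_nonneg_of_ne_top h2' (EReal.coe_ne_top _)]
  simp only [hlq, hpres]
  exact ⟨le_antisymm (limsup_coe_le_of_tendsto_sub hlim) (limsup_coe_le_of_tendsto_sub hlim'),
    le_antisymm (liminf_coe_le_of_tendsto_sub hlim') (liminf_coe_le_of_tendsto_sub hlim)⟩

end GTM
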